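/- arXiv:2306.05780 — 3 statements merged into one kernel-verified Lean document; each statement's English description precedes it below -/
import Mathlib

section
/- Let d ∈ ℕ, d ≥ 1, let p ∈ ℕ, p ≥ 1, let K ⊆ ℝ^{d+1} be open with (x_K,t_K) ∈ K, and let V ∈ C^{max(p−2,0)}(K;ℝ). Then the quasi-Trefftz space QT^p(K) is a ℂ-linear subspace of ℙ^p of dimension dim_ℂ QT^p(K) = (p+d−1)!·(2p+d)/(d!·p!) = C(p+d,d) + C(p+d−1,d), where C(n,k) denotes the binomial coefficient. -/
open scoped BigOperators
open MeasureTheory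

noncomputable section

/-- Space–time points `(x, t)` with `x ∈ ℝ^d`, `t ∈ ℝ`. -/
abbrev Pt (d : ℕ) : Type := (Fin d → ℝ) × ℝ

/-- Multi-indices `j = (j_x, j_t)`. -/
abbrev MI (d : ℕ) : Type := (Fin d → ℕ) × ℕ

/-- `|j|`, the total order of a multi-index. -/
def MI.deg {d : ℕ} (j : MI d) : ℕ := (∑ ℓ, j.1 ℓ) + j.2

/-- `j!`. -/
def MI.fact {d : ℕ} (j : MI d) : ℕ := (∏ ℓ, Nat.factorial (j.1 ℓ)) * Nat.factorial j.2

/-- componentwise difference of multi-indices. -/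
def MI.sub {d : ℕ} (j z : MI d) : MI d := (fun ℓ => j.1 ℓ - z.1 ℓ, j.2 - z.2)

/-- add `k` to the spatial component `ℓ` of a multi-index. -/
def MI.addX {d : ℕ} (j : MI d) (ℓ : Fin d) (k : ℕ) : MI d :=
  (fun m => j.1 m + if m = ℓ then k else 0, j.2)

/-- spatial canonical basis vector in `ℝ^d`. -/
def eVecd (d : ℕ) (ℓ : Fin d) : Fin d → ℝ := fun m => if m = ℓ then 1 else 0

/-- spatial unit direction in space–time. -/
def eDir (d : ℕ) (ℓ : Fin d) : Pt d := (eVecd d ℓ, 0)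

/-- time unit direction in space–time. -/
def tDir (d : ℕ) : Pt d := (0, 1)

/-- directional (partial) derivative. -/
def pd {d : ℕ} (v : Pt d) (f : Pt d → ℂ) : Pt d → ℂ := fun z => fderiv ℝ f z v

/-- the multi-index partial derivative `D^j = ∂_{x_1}^{j_1} ⋯ ∂_{x_d}^{j_d} ∂_t^{j_t}`. -/
def Dmi {d : ℕ} (j : MI d) (f : Pt d → ℂ) : Pt d → ℂ :=
  (List.finRange d).foldr (fun ℓ g => (pd (eDir d ℓ))^[j.1 ℓ] g) ((pd (tDir d))^[j.2] f)

/-- the Schrödinger operator `S f = i ∂_t f + ½ Δ_x f − V f`. -/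
def Sop {d : ℕ} (V : Pt d → ℝ) (f : Pt d → ℂ) : Pt d → ℂ := fun z =>
  Complex.I * pd (tDir d) f z
    + (1 / 2) * ∑ ℓ : Fin d, pd (eDir d ℓ) (pd (eDir d ℓ) f) z
    - (V z : ℂ) * f z

/-- all multi-indices with every component `≤ p`. -/
def MIall (d p : ℕ) : Finset (MI d) :=
  (Finset.univ : Finset ((Fin d → Fin (p + 1)) × Fin (p + 1))).image
    (fun j => ((fun ℓ => (j.1 ℓ : ℕ)), (j.2 : ℕ)))

/-- multi-indices with `|j| ≤ p`. -/
def MIle (d p : ℕ) : Finset (MI d) := (MIall d p).filter (fun j => MI.deg j ≤ p)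

/-- multi-indices with `|j| < m`. -/
def MIlt (d m : ℕ) : Finset (MI d) := (MIall d m).filter (fun j => MI.deg j < m)

/-- multi-indices with `|j| = m`. -/
def MIeq (d m : ℕ) : Finset (MI d) := (MIall d m).filter (fun j => MI.deg j = m)

/-- multi-indices `z ≤ j` (componentwise). -/
def MIbelow {d : ℕ} (j : MI d) : Finset (MI d) :=
  (MIall d (MI.deg j)).filter (fun z => (∀ ℓ, z.1 ℓ ≤ j.1 ℓ) ∧ z.2 ≤ j.2)

/-- monomial of multi-index `j`, centered at `c`, scaled by `h`. -/
def monoC {d : ℕ} (c : Pt d) (h : ℝ) (j : MI d) : Pt d → ℂ := fun z =>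
  (∏ ℓ, (((z.1 ℓ - c.1 ℓ) / h : ℝ) : ℂ) ^ j.1 ℓ) * (((z.2 - c.2) / h : ℝ) : ℂ) ^ j.2

/-- `ℙ^p`: polynomial functions `ℝ^{d+1} → ℂ` of total degree `≤ p`. -/
def PolySet (d p : ℕ) : Set (Pt d → ℂ) :=
  {q | ∃ C : MI d → ℂ, ∀ z, q z = ∑ j ∈ MIle d p, C j * monoC ((0 : Fin d → ℝ), (0 : ℝ)) 1 j z}

/-- the quasi-Trefftz space `QT^p(K)` for the potential `V`, centered at `c`:
polynomials of degree `≤ p` with `D^j(Sq)(c) = 0` for all `|j| ≤ p − 2`. -/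
def QTset (d p : ℕ) (V : Pt d → ℝ) (c : Pt d) : Set (Pt d → ℂ) :=
  {q | q ∈ PolySet d p ∧ ∀ j : MI d, MI.deg j + 2 ≤ p → Dmi j (Sop V q) c = 0}

/-- Taylor polynomial of order `m` (degree `m − 1`) centered at `c`. -/
def TaylorP {d : ℕ} (m : ℕ) (c : Pt d) (φ : Pt d → ℂ) : Pt d → ℂ := fun z =>
  ∑ j ∈ MIlt d m, ((MI.fact j : ℂ))⁻¹ * Dmi j φ c * monoC c 1 j z

/-- Euclidean distance on `ℝ^{d+1} = ℝ^d × ℝ`. -/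
def eDist {d : ℕ} (z w : Pt d) : ℝ :=
  Real.sqrt ((∑ ℓ, (z.1 ℓ - w.1 ℓ) ^ 2) + (z.2 - w.2) ^ 2)

namespace QuasiTrefftz

variable {d : ℕ}

/-- The coordinate directions of space–time: `none` is time, `some ℓ` the `ℓ`-th space direction. -/
def dir : Option (Fin d) → Pt d
  | none => tDir d
  | some ℓ => eDir d ℓ

/-- The unit multi-index of a coordinate direction. -/
def unit : Option (Fin d) → MI d
  | none => (0, 1)
  | some ℓ => (Pi.single ℓ 1, 0)

/-- The component of a multi-index in a coordinate direction. -/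
def comp (k : MI d) : Option (Fin d) → ℕ
  | none => k.2
  | some ℓ => k.1 ℓ

/-- The coordinate functions, with complex values. -/
def coord : Option (Fin d) → Pt d →L[ℝ] ℂ
  | none => Complex.ofRealCLM ∘L ContinuousLinearMap.snd ℝ _ _
  | some ℓ => Complex.ofRealCLM ∘L ContinuousLinearMap.proj ℓ ∘L ContinuousLinearMap.fst ℝ _ _

lemma coord_dir (o o' : Option (Fin d)) : coord o (dir o') = if o = o' then 1 else 0 := by
  cases o <;> cases o' <;> simp [coord, dir, tDir, eDir, eVecd]
  split_ifs <;> simp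

lemma comp_unit (o o' : Option (Fin d)) : comp (unit o) o' = if o = o' then 1 else 0 := by
  cases o <;> cases o' <;> simp [comp, unit, Pi.single_apply, eq_comm]

lemma comp_add (j k : MI d) (o : Option (Fin d)) : comp (j + k) o = comp j o + comp k o := by
  cases o <;> simp [comp]

lemma comp_sub (j k : MI d) (o : Option (Fin d)) : comp (j - k) o = comp j o - comp k o := by
  cases o <;> simp [comp]

lemma ext_comp {j k : MI d} (h : ∀ o, comp j o = comp k o) : j = k :=
  Prod.ext (funext fun ℓ => h (some ℓ)) (h none)

lemma deg_eq_sum_comp (j : MI d) : MI.deg j = ∑ o, comp j o := by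
  simp [Fintype.sum_option, MI.deg, comp, add_comm]

lemma deg_add (j k : MI d) : MI.deg (j + k) = MI.deg j + MI.deg k := by
  simp [deg_eq_sum_comp, comp_add, Finset.sum_add_distrib]

lemma deg_unit (o : Option (Fin d)) : MI.deg (unit o) = 1 := by
  simp [deg_eq_sum_comp, comp_unit]

lemma comp_le_deg (j : MI d) (o : Option (Fin d)) : comp j o ≤ MI.deg j := by
  rw [deg_eq_sum_comp]
  exact Finset.single_le_sum (fun _ _ => Nat.zero_le _) (Finset.mem_univ o)

lemma sub_unit_add {k : MI d} {o : Option (Fin d)} (h : comp k o ≠ 0) :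
    k - unit o + unit o = k := by
  refine ext_comp fun o' => ?_
  rw [comp_add, comp_sub, comp_unit]
  split_ifs with ho
  · subst ho; omega
  · simp

lemma exists_comp_ne_zero {k : MI d} (h : k ≠ 0) : ∃ o, comp k o ≠ 0 := by
  by_contra! hc
  exact h (ext_comp fun o => by rw [hc o]; cases o <;> rfl)

lemma deg_zero : MI.deg (0 : MI d) = 0 := by simp [MI.deg]

lemma deg_sub_unit {k : MI d} {o : Option (Fin d)} (h : comp k o ≠ 0) :
    MI.deg (k - unit o) + 1 = MI.deg k := by
  conv_rhs => rw [← sub_unit_add h, deg_add, deg_unit]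

theorem unit_induction {P : MI d → Prop} (zero : P 0)
    (step : ∀ k o, P k → P (k + unit o)) (k : MI d) : P k := by
  induction h : MI.deg k generalizing k with
  | zero =>
    rcases eq_or_ne k 0 with rfl | hk
    · exact zero
    · obtain ⟨o, ho⟩ := exists_comp_ne_zero hk
      have := comp_le_deg k o
      omega
  | succ n ih =>
    rcases eq_or_ne k 0 with rfl | hk
    · exact zero
    · obtain ⟨o, ho⟩ := exists_comp_ne_zero hk
      rw [← sub_unit_add ho]
      exact step _ _ (ih _ (by have := deg_sub_unit ho; omega))

lemma monoC_eq_prod (c : Pt d) (k : MI d) (z : Pt d) :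
    monoC c 1 k z = ∏ o, (coord o z - coord o c) ^ comp k o := by
  simp [monoC, Fintype.prod_option, coord, comp, mul_comm]

lemma monoC_zero (c : Pt d) : monoC c 1 0 = 1 := by
  funext z
  simp [monoC]

lemma monoC_add_unit (c : Pt d) (k : MI d) (o : Option (Fin d)) :
    monoC c 1 (k + unit o) = fun z => (coord o z - coord o c) * monoC c 1 k z := by
  funext z
  simp only [monoC_eq_prod, comp_add, pow_add, Finset.prod_mul_distrib, comp_unit]
  rw [mul_comm]
  congr 1
  rw [Finset.prod_eq_single o] <;> simp +contextual [eq_comm]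

lemma monoC_self (c : Pt d) {k : MI d} (hk : k ≠ 0) : monoC c 1 k c = 0 := by
  obtain ⟨o, ho⟩ := exists_comp_ne_zero hk
  rw [← sub_unit_add ho, monoC_add_unit]
  simp

lemma contDiff_monoC (c : Pt d) (k : MI d) {n : WithTop ℕ∞} : ContDiff ℝ n (monoC c 1 k) := by
  induction k using unit_induction with
  | zero => rw [monoC_zero]; exact contDiff_const
  | step k o ih =>
    rw [monoC_add_unit]
    exact ((coord o).contDiff.sub contDiff_const).mul ih

lemma pd_monoC (c : Pt d) (k : MI d) (o : Option (Fin d)) :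
    pd (dir o) (monoC c 1 k) = fun z => comp k o * monoC c 1 (k - unit o) z := by
  induction k using unit_induction with
  | zero =>
    funext z
    have : comp (0 : MI d) o = 0 := by cases o <;> rfl
    simp [monoC_zero, pd, this]
  | step k o' ih =>
    funext z
    have h1 : HasFDerivAt (fun z => coord o' z - coord o' c) (coord o') z :=
      (coord o').hasFDerivAt.sub_const _
    have h2 : HasFDerivAt (monoC c 1 k) (fderiv ℝ (monoC c 1 k) z) z :=
      ((contDiff_monoC c k (n := 1)).differentiable (by simp) z).hasFDerivAt
    have h3 : fderiv ℝ (monoC c 1 k) z (dir o) = comp k o * monoC c 1 (k - unit o) z :=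
      congrFun ih z
    rw [monoC_add_unit, pd]
    erw [(h1.mul h2).fderiv]
    simp only [add_apply, smul_apply, h3, coord_dir,
      smul_eq_mul, comp_add, comp_unit]
    by_cases hk : comp k o = 0
    · by_cases ho : o' = o
      · subst ho; simp [hk]
      · simp [hk, ho]
    · have h4 : k + unit o' - unit o = (k - unit o) + unit o' := by
        conv_lhs => rw [← sub_unit_add hk, add_right_comm, add_tsub_cancel_right]
      have h5 := congrFun (monoC_add_unit c (k - unit o) o') z
      rw [h4]
      by_cases ho : o' = o
      · subst ho
        rw [sub_unit_add hk] at h5 ⊢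
        simp only [if_true]
        push_cast
        linear_combination (-(comp k o' : ℂ)) * h5
      · rw [h5]
        simp only [ho, if_false]
        push_cast
        ring

/-- Iterated partial derivatives along a list of coordinate directions, head first. -/
def Dl (l : List (Option (Fin d))) (f : Pt d → ℂ) : Pt d → ℂ :=
  l.foldl (fun g o => pd (dir o) g) f

/-- The list of directions along which `Dmi j` differentiates. -/
def dirList (j : MI d) : List (Option (Fin d)) :=
  List.replicate j.2 none ++
    (List.finRange d).reverse.flatMap fun ℓ => List.replicate (j.1 ℓ) (some ℓ)

lemma Dl_cons (o : Option (Fin d)) (l : List (Option (Fin d))) (f : Pt d → ℂ) :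
    Dl (o :: l) f = Dl l (pd (dir o) f) := rfl

lemma Dl_append (l l' : List (Option (Fin d))) (f : Pt d → ℂ) :
    Dl (l ++ l') f = Dl l' (Dl l f) := List.foldl_append

lemma Dl_replicate (n : ℕ) (o : Option (Fin d)) (f : Pt d → ℂ) :
    Dl (List.replicate n o) f = (pd (dir o))^[n] f := by
  induction n generalizing f with
  | zero => rfl
  | succ n ih => rw [List.replicate_succ, Dl_cons, ih, Function.iterate_succ_apply]

lemma Dmi_eq_Dl (j : MI d) (f : Pt d → ℂ) : Dmi j f = Dl (dirList j) f := by
  have key : ∀ (L : List (Fin d)) (g : Pt d → ℂ),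
      L.foldr (fun ℓ g => (pd (eDir d ℓ))^[j.1 ℓ] g) g =
        Dl (L.reverse.flatMap fun ℓ => List.replicate (j.1 ℓ) (some ℓ)) g := by
    intro L g
    induction L with
    | nil => rfl
    | cons a L ih =>
      rw [List.foldr_cons, ih, List.reverse_cons, List.flatMap_append, Dl_append]
      simp [Dl_replicate, dir]
  rw [dirList, Dl_append, Dl_replicate, Dmi, key]
  rfl

lemma sum_map_unit_dirList (j : MI d) : ((dirList j).map unit).sum = j := by
  have key : ∀ (L : List (Fin d)),
      ((L.reverse.flatMap fun ℓ => List.replicate (j.1 ℓ) (some ℓ)).map unit).sum =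
        (L.map fun ℓ => j.1 ℓ • unit (some ℓ)).sum := by
    intro L
    induction L with
    | nil => rfl
    | cons a L ih =>
      rw [List.reverse_cons, List.flatMap_append, List.map_append, List.sum_append, ih]
      simp [add_comm]
  rw [dirList, List.map_append, List.sum_append, key, ← List.ofFn_eq_map, List.sum_ofFn]
  refine Prod.ext ?_ ?_
  · funext ℓ
    simp [unit, Prod.fst_sum, Finset.sum_apply, Pi.single_apply]
  · simp [unit, Prod.snd_sum]

lemma deg_sum_map_unit (l : List (Option (Fin d))) : MI.deg (l.map unit).sum = l.length := by
  induction l with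
  | nil => exact deg_zero
  | cons o l ih => simp [deg_add, deg_unit, ih, add_comm]

lemma length_dirList (j : MI d) : (dirList j).length = MI.deg j := by
  rw [← deg_sum_map_unit, sum_map_unit_dirList]

section Smoothness

variable {U : Set (Pt d)} {f g : Pt d → ℂ}

lemma contDiffOn_pd (hU : IsOpen U) {n : ℕ} (hf : ContDiffOn ℝ (n + 1 : ℕ) f U) (v : Pt d) :
    ContDiffOn ℝ n (pd v f) U :=
  (hf.fderiv_of_isOpen hU (by push_cast; exact le_rfl)).clm_apply contDiffOn_const

lemma differentiableAt_of_contDiffOn (hU : IsOpen U) {n : ℕ}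
    (hf : ContDiffOn ℝ (n + 1 : ℕ) f U) {z : Pt d} (hz : z ∈ U) : DifferentiableAt ℝ f z :=
  (hf.contDiffAt (hU.mem_nhds hz)).differentiableAt (by simp)

lemma Dl_congr (hU : IsOpen U) (l : List (Option (Fin d))) (h : Set.EqOn f g U) :
    Set.EqOn (Dl l f) (Dl l g) U := by
  induction l generalizing f g with
  | nil => exact h
  | cons o l ih =>
    refine ih fun z hz => ?_
    have : f =ᶠ[nhds z] g := h.eventuallyEq_of_mem (hU.mem_nhds hz)
    simp only [pd, this.fderiv_eq]

lemma Dl_add (hU : IsOpen U) (l : List (Option (Fin d))) (hf : ContDiffOn ℝ l.length f U)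
    (hg : ContDiffOn ℝ l.length g U) : Set.EqOn (Dl l (f + g)) (Dl l f + Dl l g) U := by
  induction l generalizing f g with
  | nil => exact fun _ _ => rfl
  | cons o l ih =>
    have h : Set.EqOn (pd (dir o) (f + g)) (pd (dir o) f + pd (dir o) g) U := fun z hz => by
      simp only [pd, Pi.add_apply]
      rw [fderiv_add (differentiableAt_of_contDiffOn hU hf hz)
        (differentiableAt_of_contDiffOn hU hg hz)]
      rfl
    exact (Dl_congr hU l h).trans (ih (contDiffOn_pd hU hf _) (contDiffOn_pd hU hg _))

lemma Dl_smul (l : List (Option (Fin d))) (a : ℂ) (f : Pt d → ℂ) :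
    Dl l (a • f) = a • Dl l f := by
  induction l generalizing f with
  | nil => rfl
  | cons o l ih =>
    have h : pd (dir o) (a • f) = a • pd (dir o) f := by
      funext z
      simp [pd, fderiv_const_smul_field]
    rw [Dl_cons, h, ih, Dl_cons]

lemma Dl_sum (hU : IsOpen U) (l : List (Option (Fin d))) {ι : Type*} (s : Finset ι)
    {F : ι → Pt d → ℂ} (hF : ∀ i ∈ s, ContDiffOn ℝ l.length (F i) U) :
    Set.EqOn (Dl l (∑ i ∈ s, F i)) (∑ i ∈ s, Dl l (F i)) U := by
  classical
  induction s using Finset.induction_on with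
  | empty =>
    have := Dl_smul l 0 (0 : Pt d → ℂ)
    simp only [zero_smul] at this
    simp [this, Set.EqOn]
  | insert a s ha ih =>
    rw [Finset.sum_insert ha, Finset.sum_insert ha]
    have h1 : ContDiffOn ℝ l.length (∑ i ∈ s, F i) U := by
      have := ContDiffOn.sum (t := U) (s := s) fun i hi => hF i (Finset.mem_insert_of_mem hi)
      refine this.congr fun x _ => ?_
      simp
    refine (Dl_add hU l (hF a (Finset.mem_insert_self _ _)) h1).trans fun z hz => ?_
    simp only [Pi.add_apply]
    rw [ih (fun i hi => hF i (Finset.mem_insert_of_mem hi)) hz]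

/-- A product with a monomial of high degree vanishes to high order at the center. -/
lemma Dl_mul_monoC (hU : IsOpen U) {c : Pt d} (hc : c ∈ U) (l : List (Option (Fin d)))
    (k : MI d) (hk : l.length < MI.deg k) (hg : ContDiffOn ℝ l.length g U) :
    Dl l (g * monoC c 1 k) c = 0 := by
  induction l generalizing g k with
  | nil =>
    have : k ≠ 0 := by
      rintro rfl
      simp [deg_zero] at hk
    simp [Dl, monoC_self c this]
  | cons o l ih =>
    have hm : ∀ k' : MI d, ContDiffOn ℝ l.length (monoC c 1 k') U :=
      fun k' => (contDiff_monoC c k').contDiffOn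
    have hg' : ContDiffOn ℝ l.length g U :=
      hg.of_le (by exact_mod_cast Nat.le_succ _)
    have h : Set.EqOn (pd (dir o) (g * monoC c 1 k))
        (pd (dir o) g * monoC c 1 k + (comp k o : ℂ) • (g * monoC c 1 (k - unit o))) U := by
      intro z hz
      have h3 := congrFun (pd_monoC c k o) z
      rw [pd] at h3
      simp only [pd, Pi.add_apply, Pi.mul_apply, Pi.smul_apply, smul_eq_mul]
      rw [fderiv_mul (differentiableAt_of_contDiffOn hU hg hz)
        ((contDiff_monoC c k (n := 1)).differentiable (by simp) z)]
      simp only [add_apply, smul_apply, smul_eq_mul, h3]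
      ring
    rw [List.length_cons] at hk
    rw [Dl_cons, Dl_congr hU l h hc, Dl_add (f := pd (dir o) g * monoC c 1 k)
      (g := (comp k o : ℂ) • (g * monoC c 1 (k - unit o))) hU l
      ((contDiffOn_pd hU hg _).mul (hm k)) ((hg'.mul (hm _)).const_smul (comp k o : ℂ)) hc,
      Pi.add_apply, Dl_smul,
      ih k (by omega) (contDiffOn_pd hU hg _), Pi.smul_apply, zero_add]
    by_cases ho : comp k o = 0
    · simp [ho]
    · rw [ih (k - unit o) (by have := deg_sub_unit ho; omega) hg', smul_zero]

end Smoothness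

lemma Dl_monoC_self_ne_zero (c : Pt d) (l : List (Option (Fin d))) (k : MI d) :
    Dl l (monoC c 1 k) c ≠ 0 ↔ k = (l.map unit).sum := by
  induction l generalizing k with
  | nil =>
    rcases eq_or_ne k 0 with rfl | hk
    · simp [Dl, monoC_zero]
    · simp [Dl, monoC_self c hk, hk]
  | cons o l ih =>
    have h : pd (dir o) (monoC c 1 k) = (comp k o : ℂ) • monoC c 1 (k - unit o) := pd_monoC c k o
    rw [Dl_cons, h, Dl_smul, Pi.smul_apply, smul_ne_zero_iff, ih, List.map_cons, List.sum_cons,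
      Nat.cast_ne_zero]
    constructor
    · rintro ⟨ho, h2⟩
      rw [← h2, add_comm, sub_unit_add ho]
    · rintro rfl
      exact ⟨by simp [comp_add, comp_unit], add_tsub_cancel_left _ _⟩

lemma Dmi_monoC_self_ne_zero (c : Pt d) (i k : MI d) : Dmi i (monoC c 1 k) c ≠ 0 ↔ k = i := by
  rw [Dmi_eq_Dl, Dl_monoC_self_ne_zero, sum_map_unit_dirList]

section Schrodinger

variable {U : Set (Pt d)} {V : Pt d → ℝ} {c : Pt d}

lemma Dl_Sop (hU : IsOpen U) (hc : c ∈ U) (l : List (Option (Fin d)))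
    (hV : ContDiffOn ℝ l.length V U) {q : Pt d → ℂ} (hq : ∀ n : ℕ, ContDiff ℝ n q) :
    Dl l (Sop V q) c = Complex.I * Dl (none :: l) q c
      + (1 / 2) * ∑ ℓ, Dl (some ℓ :: some ℓ :: l) q c
      - Dl l ((fun z => (V z : ℂ)) * q) c := by
  have hpd : ∀ {q : Pt d → ℂ}, (∀ n : ℕ, ContDiff ℝ n q) → ∀ v (n : ℕ), ContDiff ℝ n (pd v q) :=
    fun hq v n => contDiffOn_univ.1 (contDiffOn_pd isOpen_univ (hq (n + 1)).contDiffOn v)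
  have hVC : ContDiffOn ℝ l.length (fun z => (V z : ℂ)) U :=
    Complex.ofRealCLM.contDiff.comp_contDiffOn hV
  have h : Sop V q = (Complex.I • pd (dir none) q +
      (1 / 2 : ℂ) • ∑ ℓ : Fin d, pd (dir (some ℓ)) (pd (dir (some ℓ)) q)) +
      (-1 : ℂ) • ((fun z => (V z : ℂ)) * q) := by
    funext z
    simp [Sop, dir, sub_eq_add_neg]
  have h1 : ContDiffOn ℝ l.length (Complex.I • pd (dir none) q) U :=
    (hpd hq (dir none) _).contDiffOn.const_smul Complex.I
  have h2 : ∀ ℓ : Fin d, ContDiffOn ℝ l.length (pd (dir (some ℓ)) (pd (dir (some ℓ)) q)) U :=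
    fun ℓ => (hpd (hpd hq _) _ _).contDiffOn
  have h3 : ContDiffOn ℝ l.length
      ((1 / 2 : ℂ) • ∑ ℓ : Fin d, pd (dir (some ℓ)) (pd (dir (some ℓ)) q)) U := by
    have := (ContDiffOn.sum (s := Finset.univ) fun ℓ _ => h2 ℓ).const_smul (1 / 2 : ℂ)
    exact this.congr fun x _ => by simp
  rw [h, Dl_add (f := Complex.I • pd (dir none) q +
      (1 / 2 : ℂ) • ∑ ℓ : Fin d, pd (dir (some ℓ)) (pd (dir (some ℓ)) q))
      (g := (-1 : ℂ) • ((fun z => (V z : ℂ)) * q)) hU l (h1.add h3)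
      ((hVC.mul (hq _).contDiffOn).const_smul (-1 : ℂ)) hc, Pi.add_apply,
    Dl_add hU l h1 h3 hc, Pi.add_apply, Dl_smul, Dl_smul, Dl_smul, Pi.smul_apply, Pi.smul_apply,
    Pi.smul_apply, Dl_sum hU l Finset.univ (fun ℓ _ => h2 ℓ) hc, Finset.sum_apply]
  simp [Dl_cons, sub_eq_add_neg]

lemma Dmi_Sop_sum (hU : IsOpen U) (hc : c ∈ U) (i : MI d) (hV : ContDiffOn ℝ (MI.deg i) V U)
    {ι : Type*} (s : Finset ι) (a : ι → ℂ) {F : ι → Pt d → ℂ}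
    (hF : ∀ j (n : ℕ), ContDiff ℝ n (F j)) :
    Dmi i (Sop V (∑ j ∈ s, a j • F j)) c = ∑ j ∈ s, a j * Dmi i (Sop V (F j)) c := by
  have hV' : ContDiffOn ℝ (dirList i).length V U := by rwa [length_dirList]
  have hVC : ContDiffOn ℝ (dirList i).length (fun z => (V z : ℂ)) U :=
    Complex.ofRealCLM.contDiff.comp_contDiffOn hV'
  have hsum : ∀ n : ℕ, ContDiff ℝ n (∑ j ∈ s, a j • F j) := fun n => by
    have := ContDiff.sum (s := s) fun j _ => (hF j n).const_smul (a j)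
    convert this using 1
    funext x
    simp
  have hDl : ∀ l, Dl l (∑ j ∈ s, a j • F j) c = ∑ j ∈ s, a j * Dl l (F j) c := fun l => by
    rw [Dl_sum (F := fun j => a j • F j) hU l s
      (fun j _ => ((hF j _).const_smul (a j)).contDiffOn) hc]
    simp [Dl_smul]
  have hVs : (fun z => (V z : ℂ)) * (∑ j ∈ s, a j • F j) =
      ∑ j ∈ s, a j • ((fun z => (V z : ℂ)) * F j) := by
    simp [Finset.mul_sum]
  have hDV : Dl (dirList i) ((fun z => (V z : ℂ)) * (∑ j ∈ s, a j • F j)) c =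
      ∑ j ∈ s, a j * Dl (dirList i) ((fun z => (V z : ℂ)) * F j) c := by
    rw [hVs, Dl_sum (F := fun j => a j • ((fun z => (V z : ℂ)) * F j)) hU _ s
      (fun j _ => (hVC.mul (hF j _).contDiffOn).const_smul (a j)) hc]
    simp [Dl_smul]
  simp only [Dmi_eq_Dl]
  rw [Dl_Sop hU hc _ hV' hsum, hDV]
  simp only [hDl, Dl_Sop hU hc _ hV' (hF _), Finset.mul_sum, Finset.sum_comm (t := s),
    ← Finset.sum_add_distrib, ← Finset.sum_sub_distrib]
  refine Finset.sum_congr rfl fun j _ => ?_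
  rw [mul_sub, mul_add, Finset.mul_sum]
  congr 2
  · ring
  · exact Finset.sum_congr rfl fun ℓ _ => by ring

/-- If `q` is the monomial of multi-index `j + 2 e_ℓ` centered at `c`, then `D^i (S q)` vanishes
at `c` unless `i = j` or `i` is larger than `j`, first by degree and then by `ℓ`-th component. -/
lemma Dmi_Sop_monoC_eq_zero (hU : IsOpen U) (hc : c ∈ U) (i j : MI d) (ℓ : Fin d)
    (hV : ContDiffOn ℝ (MI.deg i) V U) (hij : i ≠ j) (hdeg : MI.deg i ≤ MI.deg j)
    (hcomp : MI.deg i = MI.deg j → comp i (some ℓ) ≤ comp j (some ℓ)) :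
    Dmi i (Sop V (monoC c 1 (j + unit (some ℓ) + unit (some ℓ)))) c = 0 := by
  have hV' : ContDiffOn ℝ (dirList i).length V U := by rwa [length_dirList]
  rw [Dmi_eq_Dl, Dl_Sop hU hc _ hV' (fun n => contDiff_monoC c _)]
  have h1 : Dl (none :: dirList i) (monoC c 1 (j + unit (some ℓ) + unit (some ℓ))) c = 0 := by
    by_contra h
    have := congrArg MI.deg ((Dl_monoC_self_ne_zero _ _ _).1 h)
    rw [List.map_cons, List.sum_cons, sum_map_unit_dirList] at this
    simp only [deg_add, deg_unit] at this
    omega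
  have h2 : ∀ m : Fin d, Dl (some m :: some m :: dirList i)
      (monoC c 1 (j + unit (some ℓ) + unit (some ℓ))) c = 0 := by
    intro m
    by_contra h
    have h := (Dl_monoC_self_ne_zero _ _ _).1 h
    rw [List.map_cons, List.sum_cons, List.map_cons, List.sum_cons, sum_map_unit_dirList] at h
    have hd := congrArg MI.deg h
    have hl := congrArg (fun k => comp k (some ℓ)) h
    simp only [deg_add, deg_unit, comp_add, comp_unit] at hd hl
    by_cases hm : m = ℓ
    · subst hm
      rw [← add_assoc, add_assoc, add_comm] at h
      exact hij (add_left_cancel h).symm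
    · have := hcomp (by omega)
      simp [hm] at hl
      omega
  have h3 : Dl (dirList i) ((fun z => (V z : ℂ)) *
      monoC c 1 (j + unit (some ℓ) + unit (some ℓ))) c = 0 :=
    Dl_mul_monoC hU hc _ _ (by rw [length_dirList]; simp only [deg_add, deg_unit]; omega)
      (Complex.ofRealCLM.contDiff.comp_contDiffOn hV')
  simp [h1, h2, h3]

lemma Dmi_Sop_monoC_ne_zero (hU : IsOpen U) (hc : c ∈ U) (i : MI d) (ℓ : Fin d)
    (hV : ContDiffOn ℝ (MI.deg i) V U) :
    Dmi i (Sop V (monoC c 1 (i + unit (some ℓ) + unit (some ℓ)))) c ≠ 0 := by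
  have hV' : ContDiffOn ℝ (dirList i).length V U := by rwa [length_dirList]
  rw [Dmi_eq_Dl, Dl_Sop hU hc _ hV' (fun n => contDiff_monoC c _)]
  have h1 : Dl (none :: dirList i) (monoC c 1 (i + unit (some ℓ) + unit (some ℓ))) c = 0 := by
    by_contra h
    have := congrArg MI.deg ((Dl_monoC_self_ne_zero _ _ _).1 h)
    rw [List.map_cons, List.sum_cons, sum_map_unit_dirList] at this
    simp only [deg_add, deg_unit] at this
    omega
  have h2 : ∀ m : Fin d, Dl (some m :: some m :: dirList i)
      (monoC c 1 (i + unit (some ℓ) + unit (some ℓ))) c ≠ 0 ↔ m = ℓ := by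
    intro m
    rw [Dl_monoC_self_ne_zero, List.map_cons, List.sum_cons, List.map_cons, List.sum_cons,
      sum_map_unit_dirList]
    constructor
    · intro h
      have hl := congrArg (fun k => comp k (some ℓ)) h
      simp only [comp_add, comp_unit] at hl
      by_contra hm
      simp [hm] at hl
      omega
    · rintro rfl
      abel
  have h3 : Dl (dirList i) ((fun z => (V z : ℂ)) *
      monoC c 1 (i + unit (some ℓ) + unit (some ℓ))) c = 0 :=
    Dl_mul_monoC hU hc _ _ (by rw [length_dirList]; simp only [deg_add, deg_unit]; omega)
      (Complex.ofRealCLM.contDiff.comp_contDiffOn hV')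
  rw [h1, h3, Finset.sum_eq_single ℓ (fun m _ hm => by
    by_contra h
    exact hm ((h2 m).1 h)) (by simp)]
  simpa using (h2 ℓ).2 rfl

end Schrodinger

section Counting

lemma mem_MIall {p : ℕ} {j : MI d} : j ∈ MIall d p ↔ ∀ o, comp j o ≤ p := by
  simp only [MIall, Finset.mem_image, Finset.mem_univ, true_and]
  constructor
  · rintro ⟨k, rfl⟩ (_ | ℓ)
    · exact Nat.lt_succ_iff.1 k.2.2
    · exact Nat.lt_succ_iff.1 (k.1 ℓ).2
  · intro h
    exact ⟨(fun ℓ => ⟨j.1 ℓ, Nat.lt_succ_iff.2 (h (some ℓ))⟩, ⟨j.2, Nat.lt_succ_iff.2 (h none)⟩),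
      rfl⟩

lemma mem_MIall_of_deg_le {p : ℕ} {j : MI d} (h : MI.deg j ≤ p) : j ∈ MIall d p :=
  mem_MIall.2 fun o => (comp_le_deg j o).trans h

lemma mem_MIle {p : ℕ} {j : MI d} : j ∈ MIle d p ↔ MI.deg j ≤ p := by
  simp only [MIle, Finset.mem_filter, and_iff_right_iff_imp]
  exact mem_MIall_of_deg_le

lemma mem_MIlt {m : ℕ} {j : MI d} : j ∈ MIlt d m ↔ MI.deg j < m := by
  simp only [MIlt, Finset.mem_filter, and_iff_right_iff_imp]
  exact fun h => mem_MIall_of_deg_le h.le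

lemma mem_MIeq {m : ℕ} {j : MI d} : j ∈ MIeq d m ↔ MI.deg j = m := by
  simp only [MIeq, Finset.mem_filter, and_iff_right_iff_imp]
  exact fun h => mem_MIall_of_deg_le h.le

lemma card_MIeq (d m : ℕ) : (MIeq d m).card = (m + d).choose d := by
  have h : (MIeq d m).card =
      ((Finset.univ : Finset (Option (Fin d))).finsuppAntidiag m).card := by
    refine Finset.card_bij' (fun j _ => Finsupp.equivFunOnFinite.symm (comp j))
      (fun f _ => ((fun ℓ => f (some ℓ)), f none)) ?_ ?_ ?_ ?_
    · intro j hj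
      rw [mem_MIeq, deg_eq_sum_comp] at hj
      simpa [Finset.mem_finsuppAntidiag] using hj
    · intro f hf
      rw [Finset.mem_finsuppAntidiag] at hf
      rw [mem_MIeq, ← hf.1, MI.deg, Fintype.sum_option, add_comm]
    · intro j _
      rfl
    · intro f _
      ext o
      cases o <;> rfl
  rw [h, Finset.card_finsuppAntidiag_nat_eq_choose, Finset.card_univ, Fintype.card_option,
    Fintype.card_fin, show d + 1 + m - 1 = m + d by omega, ← Nat.choose_symm_add]

lemma card_MIlt (d m : ℕ) : (MIlt d m).card = (m + d).choose (d + 1) := by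
  induction m with
  | zero =>
    rw [zero_add, Nat.choose_succ_self, Finset.card_eq_zero]
    ext j
    simp [mem_MIlt]
  | succ m ih =>
    have h : MIlt d (m + 1) = MIlt d m ∪ MIeq d m := by
      ext j
      rw [Finset.mem_union, mem_MIlt, mem_MIlt, mem_MIeq]
      omega
    have hd : Disjoint (MIlt d m) (MIeq d m) := by
      rw [Finset.disjoint_left]
      intro j
      rw [mem_MIlt, mem_MIeq]
      omega
    rw [h, Finset.card_union_of_disjoint hd, ih, card_MIeq, show m + 1 + d = m + d + 1 by omega,
      Nat.choose_succ_succ', add_comm]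

lemma card_MIle (d p : ℕ) : (MIle d p).card = (p + 1 + d).choose (d + 1) := by
  rw [← card_MIlt]
  congr 1
  ext j
  rw [mem_MIle, mem_MIlt, Nat.lt_succ_iff]

end Counting

section Polynomials

/-- The polynomial with given coefficients in the monomials centered at `c`. -/
def polyOfCoeff (p : ℕ) (c : Pt d) : (MIle d p → ℂ) →ₗ[ℂ] Pt d → ℂ :=
  Fintype.linearCombination ℂ fun k : MIle d p => monoC c 1 k.1

lemma polyOfCoeff_apply (p : ℕ) (c : Pt d) (C : MIle d p → ℂ) :
    polyOfCoeff p c C = ∑ k, C k • monoC c 1 k.1 := rfl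

lemma polyOfCoeff_injective (p : ℕ) (c : Pt d) : Function.Injective (polyOfCoeff p c) := by
  rw [injective_iff_map_eq_zero]
  intro C hC
  funext i
  have h : Dl (dirList i.1) (∑ k, C k • monoC c 1 k.1) c = 0 := by
    rw [← polyOfCoeff_apply, hC, ← zero_smul ℂ (0 : Pt d → ℂ), Dl_smul, zero_smul]
    rfl
  rw [Dl_sum (F := fun k : MIle d p => C k • monoC c 1 k.1) isOpen_univ _ _
    (fun k _ => ((contDiff_monoC c k.1).const_smul (C k)).contDiffOn) (Set.mem_univ c),
    Finset.sum_apply, Finset.sum_eq_single i] at h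
  · rw [Dl_smul, Pi.smul_apply, ← Dmi_eq_Dl, smul_eq_mul] at h
    exact (mul_eq_zero.1 h).resolve_right ((Dmi_monoC_self_ne_zero c i.1 i.1).2 rfl)
  · intro k _ hk
    rw [Dl_smul, Pi.smul_apply, ← Dmi_eq_Dl]
    have : Dmi i.1 (monoC c 1 k.1) c = 0 := by
      by_contra h0
      exact hk (Subtype.ext ((Dmi_monoC_self_ne_zero c i.1 k.1).1 h0))
    rw [this, smul_zero]
  · simp

/-- The span of the monomials of degree at most `p` centered at the origin. -/
def polySpan (d p : ℕ) : Submodule ℂ (Pt d → ℂ) :=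
  Submodule.span ℂ (monoC 0 1 '' {k | MI.deg k ≤ p})

lemma monoC_mem_polySpan {p : ℕ} {k : MI d} (h : MI.deg k ≤ p) : monoC 0 1 k ∈ polySpan d p :=
  Submodule.subset_span ⟨k, h, rfl⟩

lemma polySpan_mono {p q : ℕ} (h : p ≤ q) : polySpan d p ≤ polySpan d q :=
  Submodule.span_mono (Set.image_mono fun _ hk => le_trans hk h)

lemma monoC_mul (c : Pt d) (j k : MI d) : monoC c 1 j * monoC c 1 k = monoC c 1 (j + k) := by
  funext z
  simp only [Pi.mul_apply, monoC_eq_prod, comp_add, pow_add, Finset.prod_mul_distrib]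

lemma mul_mem_polySpan {p q : ℕ} {f g : Pt d → ℂ} (hf : f ∈ polySpan d p)
    (hg : g ∈ polySpan d q) : f * g ∈ polySpan d (p + q) := by
  have h := Submodule.mul_mem_mul hf hg
  rw [polySpan, polySpan, Submodule.span_mul_span] at h
  refine Submodule.span_mono ?_ h
  rintro _ ⟨_, ⟨j, hj, rfl⟩, _, ⟨k, hk, rfl⟩, rfl⟩
  exact ⟨j + k, by simp only [Set.mem_ofPred_eq, deg_add] at *; omega, (monoC_mul 0 j k).symm⟩

lemma monoC_center_mem_polySpan (c : Pt d) (k : MI d) : monoC c 1 k ∈ polySpan d (MI.deg k) := by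
  induction k using unit_induction with
  | zero =>
    rw [monoC_zero, ← monoC_zero 0]
    exact monoC_mem_polySpan le_rfl
  | step k o ih =>
    have h : (fun z => coord o z - coord o c) ∈ polySpan d 1 := by
      have : (fun z => coord o z - coord o c) =
          monoC 0 1 (0 + unit o) - coord o c • monoC 0 1 0 := by
        rw [monoC_add_unit, monoC_zero]
        funext z
        simp
      rw [this]
      refine sub_mem (monoC_mem_polySpan ?_) (Submodule.smul_mem _ _ (monoC_mem_polySpan ?_))
      · rw [zero_add, deg_unit]
      · rw [deg_zero]
        exact zero_le_one
    rw [monoC_add_unit, deg_add, deg_unit, add_comm]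
    exact mul_mem_polySpan h ih

lemma range_polyOfCoeff_zero (p : ℕ) : LinearMap.range (polyOfCoeff p 0) = polySpan d p := by
  rw [polyOfCoeff, Fintype.range_linearCombination, polySpan]
  congr 1
  ext f
  simp [mem_MIle]

lemma range_polyOfCoeff (p : ℕ) (c : Pt d) :
    LinearMap.range (polyOfCoeff p c) = polySpan d p := by
  have hfin : FiniteDimensional ℂ (polySpan d p) := by
    rw [← range_polyOfCoeff_zero]
    infer_instance
  refine Submodule.eq_of_le_of_finrank_eq ?_ ?_
  · rw [polyOfCoeff, Fintype.range_linearCombination, Submodule.span_le]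
    rintro _ ⟨k, rfl⟩
    exact polySpan_mono (mem_MIle.1 k.2) (monoC_center_mem_polySpan c k.1)
  · rw [← range_polyOfCoeff_zero, LinearMap.finrank_range_of_inj (polyOfCoeff_injective p c),
      LinearMap.finrank_range_of_inj (polyOfCoeff_injective p 0)]

lemma coe_polySpan (d p : ℕ) : (polySpan d p : Set (Pt d → ℂ)) = PolySet d p := by
  rw [← range_polyOfCoeff_zero]
  ext f
  simp only [SetLike.mem_coe, LinearMap.mem_range, PolySet, Set.mem_ofPred_eq, polyOfCoeff_apply]
  constructor
  · rintro ⟨C, rfl⟩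
    classical
    refine ⟨fun j => if h : j ∈ MIle d p then C ⟨j, h⟩ else 0, fun z => ?_⟩
    rw [Finset.sum_apply, ← Finset.sum_coe_sort (MIle d p)]
    exact Finset.sum_congr rfl fun k _ => by beta_reduce; rw [dif_pos k.2]; rfl
  · rintro ⟨C, hC⟩
    refine ⟨fun k => C k.1, funext fun z => ?_⟩
    rw [hC, Finset.sum_apply, ← Finset.sum_coe_sort (MIle d p)]
    rfl

end Polynomials

section Dimension

/-- The Taylor coefficients of `Sq` of order at most `p - 2` at `c`, as a function of the
coefficients of `q` in the monomials centered at `c`. -/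
def taylorSop (p : ℕ) (V : Pt d → ℝ) (c : Pt d) : (MIle d p → ℂ) →ₗ[ℂ] (MIlt d (p - 1) → ℂ) :=
  Fintype.linearCombination ℂ fun (k : MIle d p) (i : MIlt d (p - 1)) =>
    Dmi i.1 (Sop V (monoC c 1 k.1)) c

variable {p : ℕ} {V : Pt d → ℝ} {c : Pt d} {U : Set (Pt d)}

lemma taylorSop_apply (C : MIle d p → ℂ) (i : MIlt d (p - 1)) :
    taylorSop p V c C i = ∑ k, C k * Dmi i.1 (Sop V (monoC c 1 k.1)) c := by
  rw [taylorSop, Fintype.linearCombination_apply, Finset.sum_apply]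
  rfl

lemma taylorSop_surjective (hU : IsOpen U) (hc : c ∈ U) (ℓ : Fin d)
    (hV : ContDiffOn ℝ (p - 2 : ℕ) V U) : Function.Surjective (taylorSop p V c) := by
  classical
  have hVi : ∀ i : MIlt d (p - 1), ContDiffOn ℝ (MI.deg i.1) V U := fun i =>
    hV.of_le (by have := mem_MIlt.1 i.2; exact_mod_cast (show MI.deg i.1 ≤ p - 2 by omega))
  let φ : MIlt d (p - 1) → MIle d p := fun j => ⟨j.1 + unit (some ℓ) + unit (some ℓ), by
    have := mem_MIlt.1 j.2
    rw [mem_MIle]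
    simp only [deg_add, deg_unit]
    omega⟩
  let R : (MIlt d (p - 1) → ℂ) →ₗ[ℂ] (MIle d p → ℂ) :=
    Fintype.linearCombination ℂ fun j => Pi.single (φ j) 1
  have hR : ∀ v i, taylorSop p V c (R v) i =
      ∑ j, v j * Dmi i.1 (Sop V (monoC c 1 (φ j).1)) c := by
    intro v i
    simp only [R, Fintype.linearCombination_apply, map_sum, map_smul, Finset.sum_apply,
      Pi.smul_apply, smul_eq_mul]
    refine Finset.sum_congr rfl fun j _ => ?_
    rw [taylorSop, Fintype.linearCombination_apply_single, one_smul]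
  have hinj : Function.Injective (taylorSop p V c ∘ₗ R) := by
    rw [injective_iff_map_eq_zero]
    intro v hv
    have key : ∀ n, ∀ i : MIlt d (p - 1),
        MI.deg i.1 * (p + 1) + comp i.1 (some ℓ) = n → v i = 0 := by
      intro n
      induction n using Nat.strong_induction_on with
      | _ n ih =>
      intro i hi
      have h := congrFun hv i
      rw [LinearMap.comp_apply, hR, Finset.sum_eq_single i] at h
      · exact (mul_eq_zero.1 h).resolve_right (Dmi_Sop_monoC_ne_zero hU hc i.1 ℓ (hVi i))
      · intro j _ hji
        have hjp := mem_MIlt.1 j.2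
        have hcj := comp_le_deg j.1 (some ℓ)
        by_cases hlt : MI.deg j.1 * (p + 1) + comp j.1 (some ℓ) < n
        · rw [ih _ hlt j rfl, zero_mul]
        · rw [Dmi_Sop_monoC_eq_zero hU hc i.1 j.1 ℓ (hVi i)
            (fun h => hji (Subtype.ext h.symm)), mul_zero]
          · by_contra hdeg
            have : (MI.deg j.1 + 1) * (p + 1) ≤ MI.deg i.1 * (p + 1) :=
              Nat.mul_le_mul_right _ (by omega)
            rw [add_mul] at this
            omega
          · intro hdeg
            rw [hdeg] at hi
            omega
      · simp
    exact funext fun i => key _ i rfl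
  have hsurj := LinearMap.injective_iff_surjective.1 hinj
  rw [LinearMap.coe_comp] at hsurj
  exact hsurj.of_comp

lemma coe_map_ker_taylorSop (hU : IsOpen U) (hc : c ∈ U) (hV : ContDiffOn ℝ (p - 2 : ℕ) V U) :
    ((LinearMap.ker (taylorSop p V c)).map (polyOfCoeff p c) : Set (Pt d → ℂ)) =
      QTset d p V c := by
  have hD : ∀ (C : MIle d p → ℂ) (i : MI d) (hi : i ∈ MIlt d (p - 1)),
      Dmi i (Sop V (polyOfCoeff p c C)) c = taylorSop p V c C ⟨i, hi⟩ := by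
    intro C i hi
    have hi' := mem_MIlt.1 hi
    rw [taylorSop_apply, polyOfCoeff_apply, Dmi_Sop_sum hU hc i
      (hV.of_le (by exact_mod_cast (show MI.deg i ≤ p - 2 by omega))) _ _
      (fun k n => contDiff_monoC c k.1)]
  ext q
  rw [QTset, Set.mem_ofPred_eq, ← coe_polySpan, ← range_polyOfCoeff p c]
  simp only [SetLike.mem_coe, Submodule.mem_map, LinearMap.mem_ker, LinearMap.mem_range]
  constructor
  · rintro ⟨C, hC, rfl⟩
    refine ⟨⟨C, rfl⟩, fun i hi => ?_⟩
    rw [hD C i (mem_MIlt.2 (by omega)), hC]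
    rfl
  · rintro ⟨⟨C, rfl⟩, h⟩
    refine ⟨C, funext fun i => ?_, rfl⟩
    have := mem_MIlt.1 i.2
    rw [← hD C i.1 i.2]
    exact h i.1 (by omega)

lemma finrank_map_ker_taylorSop (hU : IsOpen U) (hc : c ∈ U) (hd : 1 ≤ d) (hp : 1 ≤ p)
    (hV : ContDiffOn ℝ (p - 2 : ℕ) V U) :
    Module.finrank ℂ ((LinearMap.ker (taylorSop p V c)).map (polyOfCoeff p c)) =
      (p + d).choose d + (p + d - 1).choose d := by
  have h := LinearMap.finrank_range_add_finrank_ker (taylorSop p V c)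
  rw [LinearMap.range_eq_top.2 (taylorSop_surjective hU hc ⟨0, hd⟩ hV), finrank_top,
    Module.finrank_fintype_fun_eq_card, Module.finrank_fintype_fun_eq_card, Fintype.card_coe,
    Fintype.card_coe, card_MIlt, card_MIle] at h
  rw [LinearEquiv.finrank_eq
    (Submodule.equivMapOfInjective _ (polyOfCoeff_injective p c) _).symm]
  obtain ⟨q, rfl⟩ : ∃ q, p = q + 1 := ⟨p - 1, by omega⟩
  rw [show q + 1 + 1 + d = (q + d + 1) + 1 by omega, Nat.choose_succ_succ' (q + d + 1),
    Nat.choose_succ_succ' (q + d), show q + 1 - 1 + d = q + d by omega] at h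
  rw [show q + 1 + d - 1 = q + d by omega, show q + 1 + d = q + d + 1 by omega]
  omega

lemma choose_add_choose_eq (d : ℕ) {p : ℕ} (hp : 1 ≤ p) :
    (((p + d).choose d + (p + d - 1).choose d : ℕ) : ℚ) =
      ((p + d - 1).factorial : ℚ) * (2 * p + d) / ((d.factorial : ℚ) * (p.factorial : ℚ)) := by
  obtain ⟨q, rfl⟩ : ∃ q, p = q + 1 := ⟨p - 1, by omega⟩
  have h1 : ((q + 1 + d).choose d : ℚ) =
      (q + 1 + d).factorial / ((q + 1).factorial * d.factorial) := by
    rw [← Nat.choose_symm_add, Nat.cast_add_choose]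
  have h2 : ((q + d).choose d : ℚ) = (q + d).factorial / (q.factorial * d.factorial) := by
    rw [← Nat.choose_symm_add, Nat.cast_add_choose]
  rw [show q + 1 + d - 1 = q + d by omega, Nat.cast_add, h1, h2,
    show q + 1 + d = q + d + 1 by omega, Nat.factorial_succ, Nat.factorial_succ]
  have := Nat.factorial_ne_zero q
  have := Nat.factorial_ne_zero d
  push_cast
  field_simp
  ring

end Dimension

end QuasiTrefftz

/-- The quasi-Trefftz space `QT^p(K)` is a `ℂ`-linear subspace of `ℙ^p`
of dimension `C(p+d,d) + C(p+d−1,d) = (p+d−1)!·(2p+d)/(d!·p!)`. -/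
theorem quasiTrefftz_dimension
    (d p : ℕ) (hd : 1 ≤ d) (hp : 1 ≤ p)
    (K : Set (Pt d)) (hK : IsOpen K) (cK : Pt d) (hcK : cK ∈ K)
    (V : Pt d → ℝ) (hV : ContDiffOn ℝ (max (p - 2) 0 : ℕ) V K) :
    ∃ W : Submodule ℂ (Pt d → ℂ),
      (W : Set (Pt d → ℂ)) = QTset d p V cK ∧
      (W : Set (Pt d → ℂ)) ⊆ PolySet d p ∧
      Module.finrank ℂ W = Nat.choose (p + d) d + Nat.choose (p + d - 1) d ∧
      ((Nat.choose (p + d) d + Nat.choose (p + d - 1) d : ℕ) : ℚ) =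
        (Nat.factorial (p + d - 1) : ℚ) * (2 * p + d) /
          ((Nat.factorial d : ℚ) * (Nat.factorial p : ℚ)) := by
  have hV' : ContDiffOn ℝ (p - 2 : ℕ) V K := by
    rwa [Nat.max_zero] at hV
  have hW := QuasiTrefftz.coe_map_ker_taylorSop hK hcK hV'
  exact ⟨_, hW, hW ▸ fun _ hq => hq.1, QuasiTrefftz.finrank_map_ker_taylorSop hK hcK hd hp hV',
    QuasiTrefftz.choose_add_choose_eq d hp⟩

end
end

section
/- Let d ∈ ℕ, d ≥ 1, let p ∈ ℕ, p ≥ 1, let K ⊆ ℝ^{d+1} be open with (x_K,t_K) ∈ K, let x_K^{(1)} denote the first coordinate of x_K, and let V ∈ C^{max(p−2,0)}(K;ℝ). Then for every polynomial function ĝ : ℝ^d → ℂ of total degree ≤ p in the variables (x_2,…,x_d,t) and every polynomial function g̃ : ℝ^d → ℂ of total degree ≤ p−1 in the same variables, there exists exactly one q ∈ QT^p(K) such that q(x_K^{(1)}, x_2,…,x_d, t) = ĝ(x_2,…,x_d,t) and (∂_{x_1}q)(x_K^{(1)}, x_2,…,x_d, t) = g̃(x_2,…,x_d,t) for all (x_2,…,x_d,t)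 ∈ ℝ^d. -/
open scoped BigOperators
open MeasureTheory

noncomputable section

/-- Unit direction of a space–time coordinate; `none` is time, `some ℓ` is the `ℓ`-th space
coordinate. -/
def axisDir (d : ℕ) : Option (Fin d) → Pt d
  | none => tDir d
  | some ℓ => eDir d ℓ

/-- Value of a space–time coordinate. -/
def axisCoord {d : ℕ} (z : Pt d) : Option (Fin d) → ℝ
  | none => z.2
  | some ℓ => z.1 ℓ

/-- Multi-indices as functions on the space–time coordinates. -/
def axisIndex {d : ℕ} (j : MI d) : Option (Fin d) → ℕ
  | none => j.2
  | some ℓ => j.1 ℓ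

/-- The multi-index with prescribed components. -/
def ofAxisIndex {d : ℕ} (α : Option (Fin d) → ℕ) : MI d := (fun ℓ => α (some ℓ), α none)

/-- The monomial with exponents `α` centered at `c`. -/
def centeredMonomial {d : ℕ} (c : Pt d) (α : Option (Fin d) → ℕ) : Pt d → ℂ := fun z =>
  ∏ i, ((axisCoord z i - axisCoord c i : ℝ) : ℂ) ^ α i

/-- Iterated partial derivatives along a list of coordinates, head first. -/
def iterPd {d : ℕ} : List (Option (Fin d)) → (Pt d → ℂ) → Pt d → ℂ
  | [], f => f
  | i :: L, f => iterPd L (pd (axisDir d i) f)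

@[simp]
lemma axisIndex_ofAxisIndex {d : ℕ} (α : Option (Fin d) → ℕ) :
    axisIndex (ofAxisIndex α) = α := by
  funext i; cases i <;> rfl

@[simp]
lemma ofAxisIndex_axisIndex {d : ℕ} (j : MI d) : ofAxisIndex (axisIndex j) = j := rfl

lemma sum_axisIndex {d : ℕ} (j : MI d) : ∑ i, axisIndex j i = MI.deg j := by
  simp [Fintype.sum_option, axisIndex, MI.deg, add_comm]

lemma monoC_one_eq_centeredMonomial {d : ℕ} (c : Pt d) (j : MI d) :
    monoC c 1 j = centeredMonomial c (axisIndex j) := by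
  funext z
  simp [monoC, centeredMonomial, Fintype.prod_option, axisIndex, axisCoord, mul_comm]

lemma centeredMonomial_eq_zero {d : ℕ} {c z : Pt d} {α : Option (Fin d) → ℕ} {i : Option (Fin d)}
    (hz : axisCoord z i = axisCoord c i) (hi : α i ≠ 0) : centeredMonomial c α z = 0 := by
  unfold centeredMonomial
  exact Finset.prod_eq_zero (Finset.mem_univ i) (by simp [hz, hi])

lemma centeredMonomial_eq_mul_prod_erase {d : ℕ} (c z : Pt d) (α : Option (Fin d) → ℕ)
    (i : Option (Fin d)) :
    centeredMonomial c α z = ((axisCoord z i - axisCoord c i : ℝ) : ℂ) ^ α i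
      * ∏ j ∈ Finset.univ.erase i, ((axisCoord z j - axisCoord c j : ℝ) : ℂ) ^ α j :=
  (Finset.mul_prod_erase _ _ (Finset.mem_univ i)).symm

lemma contDiff_axisCoord {d : ℕ} (i : Option (Fin d)) :
    ContDiff ℝ ⊤ (fun z : Pt d => axisCoord z i) := by
  cases i with
  | none => exact contDiff_snd
  | some ℓ => exact (contDiff_apply ℝ ℝ ℓ).comp contDiff_fst

lemma contDiff_centeredMonomial {d : ℕ} (c : Pt d) (α : Option (Fin d) → ℕ) :
    ContDiff ℝ ⊤ (centeredMonomial c α) := by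
  unfold centeredMonomial
  refine contDiff_prod fun i _ => ContDiff.pow ?_ _
  exact Complex.ofRealCLM.contDiff.comp ((contDiff_axisCoord i).sub contDiff_const)

lemma axisCoord_add_smul_axisDir {d : ℕ} (z : Pt d) (s : ℝ) (i j : Option (Fin d)) :
    axisCoord (z + s • axisDir d i) j = axisCoord z j + if j = i then s else 0 := by
  cases i <;> cases j <;> simp [axisCoord, axisDir, tDir, eDir, eVecd]

lemma pd_centeredMonomial {d : ℕ} (c : Pt d) (α : Option (Fin d) → ℕ) (i : Option (Fin d)) :
    pd (axisDir d i) (centeredMonomial c α)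
      = fun z => (α i : ℂ) * centeredMonomial c (α - Pi.single i 1) z := by
  funext z
  have hdiff : DifferentiableAt ℝ (centeredMonomial c α) z :=
    (contDiff_centeredMonomial c α).differentiable (by simp) z
  unfold pd
  rw [← hdiff.lineDeriv_eq_fderiv]
  set u : Option (Fin d) → ℂ := fun j => ((axisCoord z j - axisCoord c j : ℝ) : ℂ) with hu
  have hline : ∀ s : ℝ, centeredMonomial c α (z + s • axisDir d i)
      = (u i + s) ^ α i * ∏ j ∈ Finset.univ.erase i, u j ^ α j := by
    intro s
    rw [centeredMonomial_eq_mul_prod_erase c _ α i]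
    congr 1
    · rw [axisCoord_add_smul_axisDir]; simp only [hu, if_true]; push_cast; ring
    · refine Finset.prod_congr rfl fun j hj => ?_
      rw [axisCoord_add_smul_axisDir, if_neg (Finset.ne_of_mem_erase hj), add_zero]
  have hrest : centeredMonomial c (α - Pi.single i 1) z
      = u i ^ (α i - 1) * ∏ j ∈ Finset.univ.erase i, u j ^ α j := by
    rw [centeredMonomial_eq_mul_prod_erase c z _ i]
    congr 1
    · simp [hu]
    · refine Finset.prod_congr rfl fun j hj => ?_
      simp [hu, Pi.single_eq_of_ne (Finset.ne_of_mem_erase hj)]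
  rw [hrest]
  unfold lineDeriv
  simp_rw [hline]
  have h1 : HasDerivAt (fun s : ℝ => u i + (s : ℂ)) 1 0 :=
    (Complex.ofRealCLM.hasDerivAt (x := (0 : ℝ))).const_add (u i)
  have h2 := ((h1.pow (α i)).mul_const (∏ j ∈ Finset.univ.erase i, u j ^ α j)).deriv
  simp only [Pi.pow_apply] at h2
  rw [h2]
  simp [mul_assoc]

section Linearity

variable {d : ℕ} {c : Pt d}

lemma pd_congr {v : Pt d} {f g : Pt d → ℂ} (h : f =ᶠ[nhds c] g) :
    pd v f =ᶠ[nhds c] pd v g :=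
  (h.fderiv (𝕜 := ℝ)).mono fun z hz => by simp only [pd, hz]

lemma iterPd_congr (L : List (Option (Fin d))) {f g : Pt d → ℂ} (h : f =ᶠ[nhds c] g) :
    iterPd L f c = iterPd L g c := by
  induction L generalizing f g with
  | nil => exact h.self_of_nhds
  | cons i L ih => exact ih (pd_congr h)

lemma ContDiffAt.pd {n : ℕ} {v : Pt d} {f : Pt d → ℂ}
    (hf : ContDiffAt ℝ ((n + 1 : ℕ) : WithTop ℕ∞) f c) :
    ContDiffAt ℝ (n : WithTop ℕ∞) (pd v f) c :=
  (hf.fderiv_right (m := (n : WithTop ℕ∞)) (by simp)).clm_apply contDiffAt_const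

lemma ContDiffAt.eventually_differentiableAt {n : ℕ} {f : Pt d → ℂ}
    (hf : ContDiffAt ℝ ((n + 1 : ℕ) : WithTop ℕ∞) f c) :
    ∀ᶠ z in nhds c, DifferentiableAt ℝ f z :=
  ((hf.of_le (m := ((1 : ℕ) : WithTop ℕ∞)) (by exact_mod_cast Nat.le_add_left 1 n)).eventually
    (by simp)).mono fun z hz => hz.differentiableAt (by simp)

lemma iterPd_add (L : List (Option (Fin d))) {f g : Pt d → ℂ}
    (hf : ContDiffAt ℝ (L.length : WithTop ℕ∞) f c)
    (hg : ContDiffAt ℝ (L.length : WithTop ℕ∞) g c) :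
    iterPd L (fun z => f z + g z) c = iterPd L f c + iterPd L g c := by
  induction L generalizing f g with
  | nil => rfl
  | cons i L ih =>
    simp only [List.length_cons] at hf hg
    refine (iterPd_congr L ?_).trans (ih hf.pd hg.pd)
    filter_upwards [hf.eventually_differentiableAt, hg.eventually_differentiableAt] with z h1 h2
    simp [pd, fderiv_fun_add h1 h2]

lemma iterPd_const_mul (L : List (Option (Fin d))) (a : ℂ) {f : Pt d → ℂ}
    (hf : ContDiffAt ℝ (L.length : WithTop ℕ∞) f c) :
    iterPd L (fun z => a * f z) c = a * iterPd L f c := by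
  induction L generalizing f with
  | nil => rfl
  | cons i L ih =>
    simp only [List.length_cons] at hf
    refine (iterPd_congr L ?_).trans (ih hf.pd)
    filter_upwards [hf.eventually_differentiableAt] with z h1
    simp [pd, fderiv_const_mul h1]

lemma iterPd_zero (L : List (Option (Fin d))) : iterPd L (fun _ => 0) c = 0 := by
  simpa using iterPd_const_mul L (0 : ℂ) (f := fun _ => 0) (c := c) contDiffAt_const

lemma iterPd_sum {κ : Type*} (L : List (Option (Fin d))) (s : Finset κ) {f : κ → Pt d → ℂ}
    (hf : ∀ k ∈ s, ContDiffAt ℝ (L.length : WithTop ℕ∞) (f k) c) :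
    iterPd L (fun z => ∑ k ∈ s, f k z) c = ∑ k ∈ s, iterPd L (f k) c := by
  classical
  induction s using Finset.induction_on with
  | empty => simpa using iterPd_zero L
  | insert k s hk ih =>
    have hs : ∀ k ∈ s, ContDiffAt ℝ (L.length : WithTop ℕ∞) (f k) c :=
      fun k hk => hf k (Finset.mem_insert_of_mem hk)
    simp only [Finset.sum_insert hk]
    rw [iterPd_add L (hf k (Finset.mem_insert_self _ _)) (ContDiffAt.sum hs), ih hs]

/-- If the derivatives of `P` up to order `L.length` vanish at `c`, so does the derivative of
`g * P` along `L`. -/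
lemma iterPd_mul_eq_zero (L : List (Option (Fin d))) {g P : Pt d → ℂ}
    (hg : ContDiffAt ℝ (L.length : WithTop ℕ∞) g c)
    (hP : ContDiffAt ℝ (L.length : WithTop ℕ∞) P c)
    (hzero : ∀ L' : List (Option (Fin d)), L'.length ≤ L.length → iterPd L' P c = 0) :
    iterPd L (fun z => g z * P z) c = 0 := by
  induction L generalizing g P with
  | nil =>
    have := hzero [] le_rfl
    simp only [iterPd] at this ⊢
    simp [this]
  | cons i L ih =>
    simp only [List.length_cons] at hg hP hzero
    have hle : (L.length : WithTop ℕ∞) ≤ ((L.length + 1 : ℕ) : WithTop ℕ∞) := by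
      exact_mod_cast Nat.le_succ _
    have hg' := hg.of_le hle
    have hP' := hP.of_le hle
    have hprod : pd (axisDir d i) (fun z => g z * P z)
        =ᶠ[nhds c] fun z => g z * pd (axisDir d i) P z + pd (axisDir d i) g z * P z := by
      filter_upwards [hg.eventually_differentiableAt, hP.eventually_differentiableAt] with z h1 h2
      simp [pd, fderiv_fun_mul h1 h2, mul_comm]
    change iterPd L (pd (axisDir d i) fun z => g z * P z) c = 0
    rw [iterPd_congr L hprod, iterPd_add L (hg'.mul hP.pd) (hg.pd.mul hP'),
      ih hg' hP.pd fun L' hL' => hzero (i :: L') (by simpa using hL'),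
      ih hg.pd hP' fun L' hL' => hzero L' (by omega), add_zero]

end Linearity

lemma ContDiff.natCast {d : ℕ} {f : Pt d → ℂ} (hf : ContDiff ℝ ⊤ f) (n : ℕ) (c : Pt d) :
    ContDiffAt ℝ (n : WithTop ℕ∞) f c :=
  (hf.of_le le_top).contDiffAt

lemma iterPd_centeredMonomial {d : ℕ} (c : Pt d) (L : List (Option (Fin d)))
    (α : Option (Fin d) → ℕ) :
    iterPd L (centeredMonomial c α) c
      = if (fun i => L.count i) = α then ∏ i, ((α i).factorial : ℂ) else 0 := by
  induction L generalizing α with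
  | nil =>
    simp only [iterPd]
    by_cases h : (fun i => ([] : List (Option (Fin d))).count i) = α
    · rw [if_pos h, ← h]; simp [centeredMonomial]
    · rw [if_neg h]
      obtain ⟨i, hi⟩ := Function.ne_iff.mp h
      exact centeredMonomial_eq_zero rfl fun h0 => hi h0.symm
  | cons i L ih =>
    change iterPd L (pd (axisDir d i) (centeredMonomial c α)) c = _
    rw [pd_centeredMonomial, iterPd_const_mul L _ ((contDiff_centeredMonomial c _).natCast _ c), ih]
    rcases Nat.eq_zero_or_pos (α i) with h0 | hpos
    · have hne : (fun j => (i :: L).count j) ≠ α := fun h => by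
        have := congrFun h i
        simp [h0] at this
      rw [if_neg hne, h0, Nat.cast_zero, zero_mul]
    · have hiff : ((fun j => L.count j) = α - Pi.single i 1)
          ↔ (fun j => (i :: L).count j) = α := by
        simp only [funext_iff, List.count_cons, Pi.sub_apply]
        refine forall_congr' fun j => ?_
        by_cases hj : j = i
        · subst hj; simp; omega
        · simp [hj, Ne.symm hj]
      simp only [hiff, mul_ite, mul_zero]
      refine if_congr Iff.rfl ?_ rfl
      rw [← Finset.mul_prod_erase _ _ (Finset.mem_univ i),
        ← Finset.mul_prod_erase _ (fun j => ((α j).factorial : ℂ)) (Finset.mem_univ i), ← mul_assoc]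
      congr 1
      · rw [← Nat.mul_factorial_pred hpos.ne']; simp
      · refine Finset.prod_congr rfl fun j hj => ?_
        simp [Pi.single_eq_of_ne (Finset.ne_of_mem_erase hj)]

lemma sum_count_eq_length {κ : Type*} [Fintype κ] [BEq κ] [LawfulBEq κ] (L : List κ) :
    ∑ i, L.count i = L.length := by
  classical
  induction L with
  | nil => simp
  | cons k L ih => simp [List.count_cons, Finset.sum_add_distrib, ih]

lemma exists_list_Dmi_eq_iterPd {d : ℕ} (j : MI d) :
    ∃ L : List (Option (Fin d)), (fun i => L.count i) = axisIndex j ∧ ∀ f, Dmi j f = iterPd L f := by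
  have hiter : ∀ (i : Option (Fin d)) (n : ℕ) (L : List (Option (Fin d))) (f : Pt d → ℂ),
      (pd (axisDir d i))^[n] (iterPd L f) = iterPd (L ++ List.replicate n i) f := by
    intro i n L f
    induction L generalizing f with
    | nil =>
      induction n generalizing f with
      | zero => rfl
      | succ n ih => exact ih (pd (axisDir d i) f)
    | cons k L ih => exact ih _
  suffices h : ∀ l : List (Fin d), l.Nodup → ∃ L : List (Option (Fin d)),
      (∀ i, L.count i = match i with
        | none => j.2
        | some ℓ => if ℓ ∈ l then j.1 ℓ else 0) ∧
      ∀ f, l.foldr (fun ℓ g => (pd (eDir d ℓ))^[j.1 ℓ] g) ((pd (tDir d))^[j.2] f) = iterPd L f by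
    obtain ⟨L, h1, h2⟩ := h _ (List.nodup_finRange d)
    refine ⟨L, funext fun i => ?_, h2⟩
    rw [h1]
    cases i <;> simp [axisIndex]
  intro l hl
  induction l with
  | nil =>
    refine ⟨List.replicate j.2 none, fun i => ?_, fun f => hiter none j.2 [] f⟩
    cases i <;> simp [List.count_replicate]
  | cons ℓ l ih =>
    obtain ⟨hmem, hl⟩ := List.nodup_cons.mp hl
    obtain ⟨L, h1, h2⟩ := ih hl
    refine ⟨L ++ List.replicate (j.1 ℓ) (some ℓ), fun i => ?_, fun f => ?_⟩
    · rw [List.count_append, h1]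
      cases i with
      | none => simp [List.count_replicate]
      | some m =>
        by_cases hm : m = ℓ
        · subst hm; simp [hmem]
        · simp [List.count_replicate, hm, Ne.symm hm]
    · rw [List.foldr_cons, h2]
      exact hiter (some ℓ) _ L f

/-- Exponents of total degree at most `p`. -/
def degreeLE (d p : ℕ) : Finset (Option (Fin d) → ℕ) :=
  (Finset.Iic fun _ => p).filter fun α => ∑ i, α i ≤ p

lemma mem_degreeLE {d p : ℕ} {α : Option (Fin d) → ℕ} : α ∈ degreeLE d p ↔ ∑ i, α i ≤ p := by
  simp only [degreeLE, Finset.mem_filter, Finset.mem_Iic, and_iff_right_iff_imp]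
  exact fun h i => (Finset.single_le_sum (fun _ _ => Nat.zero_le _) (Finset.mem_univ i)).trans h

/-- The polynomial function with coefficients `C` in the monomials centered at `c`. -/
def centeredPoly {d : ℕ} (c : Pt d) (p : ℕ) (C : (Option (Fin d) → ℕ) → ℂ) : Pt d → ℂ := fun z =>
  ∑ α ∈ degreeLE d p, C α * centeredMonomial c α z

lemma mem_MIle {d p : ℕ} {j : MI d} : j ∈ MIle d p ↔ MI.deg j ≤ p := by
  simp only [MIle, MIall, Finset.mem_filter, Finset.mem_image, Finset.mem_univ, true_and,
    and_iff_right_iff_imp]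
  intro h
  have hle : ∀ i, axisIndex j i < p + 1 := fun i => Nat.lt_succ_of_le <|
    (Finset.single_le_sum (fun _ _ => Nat.zero_le _) (Finset.mem_univ i)).trans
      ((sum_axisIndex j).trans_le h)
  exact ⟨(fun ℓ => ⟨j.1 ℓ, hle (some ℓ)⟩, ⟨j.2, hle none⟩), rfl⟩

/-- Linear span of the monomials of degree at most `p` centered at `c`. -/
def degreeSpan {d : ℕ} (c : Pt d) (p : ℕ) : Submodule ℂ (Pt d → ℂ) :=
  Submodule.span ℂ (centeredMonomial c '' (degreeLE d p : Set (Option (Fin d) → ℕ)))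

lemma mem_degreeSpan {d p : ℕ} {c : Pt d} {q : Pt d → ℂ} :
    q ∈ degreeSpan c p ↔ ∃ C, q = centeredPoly c p C := by
  rw [degreeSpan, Submodule.mem_span_image_finset_iff_exists_fun']
  refine exists_congr fun C => ?_
  rw [eq_comm]
  refine Eq.congr rfl ?_
  funext z
  simp [centeredPoly, Finset.sum_apply]

lemma mem_PolySet_iff_mem_degreeSpan_zero {d p : ℕ} {q : Pt d → ℂ} :
    q ∈ PolySet d p ↔ q ∈ degreeSpan (0 : Pt d) p := by
  have hsum : ∀ C : MI d → ℂ, ∀ z : Pt d,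
      ∑ j ∈ MIle d p, C j * monoC ((0 : Fin d → ℝ), (0 : ℝ)) 1 j z
        = centeredPoly 0 p (fun α => C (ofAxisIndex α)) z := by
    intro C z
    refine Finset.sum_bij' (fun j _ => axisIndex j) (fun α _ => ofAxisIndex α) ?_ ?_ ?_ ?_ ?_
    · intro j hj
      rw [mem_degreeLE, sum_axisIndex]
      exact mem_MIle.mp hj
    · intro α hα
      rw [mem_MIle, ← sum_axisIndex, axisIndex_ofAxisIndex]
      exact mem_degreeLE.mp hα
    · exact fun _ _ => rfl
    · exact fun α _ => axisIndex_ofAxisIndex α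
    · intro j _
      rw [monoC_one_eq_centeredMonomial]
      rfl
  rw [mem_degreeSpan]
  constructor
  · rintro ⟨C, hC⟩
    exact ⟨_, funext fun z => (hC z).trans (hsum C z)⟩
  · rintro ⟨C, rfl⟩
    refine ⟨fun j => C (axisIndex j), fun z => ?_⟩
    rw [hsum]
    simp only [axisIndex_ofAxisIndex]

lemma centeredMonomial_mem_degreeSpan {d p : ℕ} (c : Pt d) {α : Option (Fin d) → ℕ}
    (h : ∑ i, α i ≤ p) : centeredMonomial c α ∈ degreeSpan c p :=
  Submodule.subset_span ⟨α, mem_degreeLE.mpr h, rfl⟩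

lemma degreeSpan_mul_mem {d a b : ℕ} {c : Pt d} {f g : Pt d → ℂ}
    (hf : f ∈ degreeSpan c a) (hg : g ∈ degreeSpan c b) : f * g ∈ degreeSpan c (a + b) := by
  have hle : degreeSpan c a * degreeSpan c b ≤ degreeSpan c (a + b) := by
    unfold degreeSpan
    rw [Submodule.span_mul_span, Submodule.span_le]
    rintro _ ⟨_, ⟨α, hα, rfl⟩, _, ⟨β, hβ, rfl⟩, rfl⟩
    have hmul : centeredMonomial c α * centeredMonomial c β = centeredMonomial c (α + β) := by
      funext z
      simp [centeredMonomial, pow_add, Finset.prod_mul_distrib]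
    simp only [hmul]
    refine centeredMonomial_mem_degreeSpan c ?_
    simp only [Pi.add_apply, Finset.sum_add_distrib]
    exact add_le_add (mem_degreeLE.mp hα) (mem_degreeLE.mp hβ)
  exact hle (Submodule.mul_mem_mul hf hg)

lemma one_mem_degreeSpan {d : ℕ} (c : Pt d) (p : ℕ) : (1 : Pt d → ℂ) ∈ degreeSpan c p := by
  have h := centeredMonomial_mem_degreeSpan (p := p) c (α := 0) (by simp)
  convert h using 1
  funext z
  simp [centeredMonomial]

lemma centeredMonomial_mem_degreeSpan_of_center {d : ℕ} (c c' : Pt d) (α : Option (Fin d) → ℕ) :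
    centeredMonomial c' α ∈ degreeSpan c (∑ i, α i) := by
  have hlin : ∀ i, (fun z : Pt d => ((axisCoord z i - axisCoord c' i : ℝ) : ℂ))
      ∈ degreeSpan c 1 := by
    intro i
    have h1 := centeredMonomial_mem_degreeSpan (p := 1) c (α := Pi.single i 1) (by simp)
    have h2 := (degreeSpan c 1).smul_mem ((axisCoord c i - axisCoord c' i : ℝ) : ℂ)
      (one_mem_degreeSpan c 1)
    convert (degreeSpan c 1).add_mem h1 h2 using 1
    funext z
    have : centeredMonomial c (Pi.single i 1) z = ((axisCoord z i - axisCoord c i : ℝ) : ℂ) := by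
      unfold centeredMonomial
      rw [Finset.prod_eq_single i (fun j _ hj => by simp [hj]) (by simp)]
      simp
    simp [this]
  have hpow : ∀ i (n : ℕ), (fun z : Pt d => ((axisCoord z i - axisCoord c' i : ℝ) : ℂ)) ^ n
      ∈ degreeSpan c n := by
    intro i n
    induction n with
    | zero => simpa using one_mem_degreeSpan c 0
    | succ n ih => rw [pow_succ]; exact degreeSpan_mul_mem ih (hlin i)
  have hprod : ∀ s : Finset (Option (Fin d)),
      ∏ i ∈ s, (fun z : Pt d => ((axisCoord z i - axisCoord c' i : ℝ) : ℂ)) ^ α i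
        ∈ degreeSpan c (∑ i ∈ s, α i) := by
    intro s
    induction s using Finset.induction_on with
    | empty => simpa using one_mem_degreeSpan c 0
    | insert i s hi ih =>
      rw [Finset.prod_insert hi, Finset.sum_insert hi]
      exact degreeSpan_mul_mem (hpow i _) ih
  convert hprod Finset.univ using 1
  funext z
  simp [centeredMonomial, Finset.prod_apply]

lemma degreeSpan_le_degreeSpan {d : ℕ} (c c' : Pt d) (p : ℕ) :
    degreeSpan c' p ≤ degreeSpan c p := by
  refine Submodule.span_le.mpr ?_
  rintro _ ⟨α, hα, rfl⟩
  have hα' : ∑ i, α i ≤ p := mem_degreeLE.mp hα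
  have h := degreeSpan_mul_mem (centeredMonomial_mem_degreeSpan_of_center c c' α)
    (one_mem_degreeSpan c (p - ∑ i, α i))
  rwa [mul_one, Nat.add_sub_cancel' hα'] at h

lemma mem_PolySet_iff {d p : ℕ} (c : Pt d) {q : Pt d → ℂ} :
    q ∈ PolySet d p ↔ ∃ C, q = centeredPoly c p C := by
  rw [mem_PolySet_iff_mem_degreeSpan_zero, ← mem_degreeSpan]
  exact ⟨fun h => degreeSpan_le_degreeSpan _ _ _ h, fun h => degreeSpan_le_degreeSpan _ _ _ h⟩

lemma contDiff_mul_centeredMonomial {d : ℕ} (c : Pt d) (a : ℂ) (α : Option (Fin d) → ℕ) :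
    ContDiff ℝ ⊤ fun z => a * centeredMonomial c α z :=
  contDiff_const.mul (contDiff_centeredMonomial c α)

lemma contDiff_centeredPoly {d : ℕ} (c : Pt d) (p : ℕ) (C : (Option (Fin d) → ℕ) → ℂ) :
    ContDiff ℝ ⊤ (centeredPoly c p C) :=
  ContDiff.sum fun α _ => contDiff_mul_centeredMonomial c (C α) α

lemma iterPd_sum_mul_centeredMonomial {d : ℕ} (c : Pt d) (L : List (Option (Fin d)))
    (s : Finset (Option (Fin d) → ℕ)) (C : (Option (Fin d) → ℕ) → ℂ) :
    iterPd L (fun z => ∑ α ∈ s, C α * centeredMonomial c α z) c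
      = ∑ α ∈ s, C α * iterPd L (centeredMonomial c α) c := by
  rw [iterPd_sum L s fun α _ => (contDiff_mul_centeredMonomial c (C α) α).natCast _ c]
  exact Finset.sum_congr rfl fun α _ =>
    iterPd_const_mul L _ ((contDiff_centeredMonomial c α).natCast _ c)

lemma exists_list_count_eq {κ : Type*} [Fintype κ] [BEq κ] [LawfulBEq κ] (α : κ → ℕ) :
    ∃ L : List κ, (fun i => L.count i) = α := by
  classical
  refine ⟨Finset.univ.toList.flatMap fun i => List.replicate (α i) i, funext fun i => ?_⟩
  rw [List.count_flatMap, Finset.sum_map_toList]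
  simp [List.count_replicate]

lemma prod_factorial_ne_zero {κ : Type*} [Fintype κ] (α : κ → ℕ) :
    ∏ i, ((α i).factorial : ℂ) ≠ 0 :=
  Finset.prod_ne_zero_iff.mpr fun _ _ => Nat.cast_ne_zero.mpr (Nat.factorial_ne_zero _)

lemma coeff_eq_zero_of_sum_eq_zero {d : ℕ} (c : Pt d) {s : Finset (Option (Fin d) → ℕ)}
    {C : (Option (Fin d) → ℕ) → ℂ} (h : ∀ z, ∑ α ∈ s, C α * centeredMonomial c α z = 0) :
    ∀ α ∈ s, C α = 0 := by
  intro α hα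
  obtain ⟨L, hL⟩ := exists_list_count_eq α
  subst hL
  have h1 := iterPd_sum_mul_centeredMonomial c L s C
  rw [funext h, iterPd_zero] at h1
  simp only [iterPd_centeredMonomial, mul_ite, mul_zero, Finset.sum_ite_eq] at h1
  rw [if_pos hα] at h1
  exact (mul_eq_zero.mp h1.symm).resolve_right (prod_factorial_ne_zero fun i => L.count i)

section Schroedinger

variable {d : ℕ} {c : Pt d} {V : Pt d → ℝ}

lemma ContDiffAt.ofReal_comp {n : WithTop ℕ∞} (hV : ContDiffAt ℝ n V c) :
    ContDiffAt ℝ n (fun z => (V z : ℂ)) c :=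
  Complex.ofRealCLM.contDiff.contDiffAt.comp c hV

lemma iterPd_Sop (L : List (Option (Fin d))) (hV : ContDiffAt ℝ (L.length : WithTop ℕ∞) V c)
    {f : Pt d → ℂ} (hf : ContDiff ℝ ⊤ f) :
    iterPd L (Sop V f) c = Complex.I * iterPd (none :: L) f c
      + (1 / 2) * ∑ ℓ, iterPd (some ℓ :: some ℓ :: L) f c
      - iterPd L (fun z => (V z : ℂ) * f z) c := by
  have ht : ContDiffAt ℝ (L.length : WithTop ℕ∞) (pd (tDir d) f) c := (hf.natCast _ c).pd
  have hx : ∀ ℓ, ContDiffAt ℝ (L.length : WithTop ℕ∞) (pd (eDir d ℓ) (pd (eDir d ℓ) f)) c :=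
    fun ℓ => ((hf.natCast (L.length + 1 + 1) c).pd).pd
  have hVf : ContDiffAt ℝ (L.length : WithTop ℕ∞) (fun z => (V z : ℂ) * f z) c :=
    hV.ofReal_comp.mul (hf.natCast _ c)
  have hxs := ContDiffAt.sum (s := Finset.univ) fun ℓ _ => hx ℓ
  have heq : Sop V f = fun z => (Complex.I * pd (tDir d) f z
      + (1 / 2) * ∑ ℓ : Fin d, pd (eDir d ℓ) (pd (eDir d ℓ) f) z)
      + (-1) * ((V z : ℂ) * f z) := by
    funext z; simp only [Sop]; ring
  rw [heq, iterPd_add L ((contDiffAt_const.mul ht).add (contDiffAt_const.mul hxs))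
      (contDiffAt_const.mul hVf), iterPd_add L (contDiffAt_const.mul ht) (contDiffAt_const.mul hxs),
    iterPd_const_mul L _ ht, iterPd_const_mul L _ hxs, iterPd_const_mul L _ hVf,
    iterPd_sum L _ fun ℓ _ => hx ℓ]
  simp only [iterPd, axisDir]
  ring

lemma iterPd_Sop_centeredPoly (L : List (Option (Fin d)))
    (hV : ContDiffAt ℝ (L.length : WithTop ℕ∞) V c) (p : ℕ) (C : (Option (Fin d) → ℕ) → ℂ) :
    iterPd L (Sop V (centeredPoly c p C)) c
      = ∑ α ∈ degreeLE d p, C α * iterPd L (Sop V (centeredMonomial c α)) c := by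
  have hVsum : iterPd L (fun z => (V z : ℂ) * centeredPoly c p C z) c
      = ∑ α ∈ degreeLE d p, C α * iterPd L (fun z => (V z : ℂ) * centeredMonomial c α z) c := by
    have hVm : ∀ α, ContDiffAt ℝ (L.length : WithTop ℕ∞)
        (fun z => (V z : ℂ) * centeredMonomial c α z) c :=
      fun α => hV.ofReal_comp.mul ((contDiff_centeredMonomial c α).natCast _ c)
    have heq : (fun z => (V z : ℂ) * centeredPoly c p C z)
        = fun z => ∑ α ∈ degreeLE d p, C α * ((V z : ℂ) * centeredMonomial c α z) := by
      funext z
      rw [centeredPoly, Finset.mul_sum]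
      exact Finset.sum_congr rfl fun α _ => by ring
    rw [heq, iterPd_sum L _ fun α _ => contDiffAt_const.mul (hVm α)]
    exact Finset.sum_congr rfl fun α _ => iterPd_const_mul L _ (hVm α)
  rw [iterPd_Sop L hV (contDiff_centeredPoly c p C), hVsum]
  have hpoly : ∀ L, iterPd L (centeredPoly c p C) c
      = ∑ α ∈ degreeLE d p, C α * iterPd L (centeredMonomial c α) c :=
    fun L => iterPd_sum_mul_centeredMonomial c L _ C
  simp only [hpoly, fun α => iterPd_Sop L hV (contDiff_centeredMonomial c α)]
  rw [Finset.sum_comm, Finset.mul_sum, Finset.mul_sum, ← Finset.sum_add_distrib,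
    ← Finset.sum_sub_distrib]
  refine Finset.sum_congr rfl fun α _ => ?_
  rw [← Finset.mul_sum]
  ring

/-- Only the Laplacian contributes when a derivative of order at most `|γ| - 2` of the Schrödinger
operator applied to the monomial of exponent `γ` is evaluated at the center. -/
lemma iterPd_Sop_centeredMonomial (L : List (Option (Fin d)))
    (hV : ContDiffAt ℝ (L.length : WithTop ℕ∞) V c) (γ : Option (Fin d) → ℕ)
    (hγ : L.length + 2 ≤ ∑ i, γ i) :
    iterPd L (Sop V (centeredMonomial c γ)) c
      = (1 / 2) * ∑ ℓ : Fin d, if (fun i => (some ℓ :: some ℓ :: L).count i) = γ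
          then ∏ i, ((γ i).factorial : ℂ) else 0 := by
  have hlow : ∀ L' : List (Option (Fin d)), L'.length ≤ L.length + 1 →
      iterPd L' (centeredMonomial c γ) c = 0 := by
    intro L' hL'
    rw [iterPd_centeredMonomial, if_neg]
    rintro rfl
    have : ∑ i, (fun i => L'.count i) i = L'.length := sum_count_eq_length L'
    omega
  rw [iterPd_Sop L hV (contDiff_centeredMonomial c γ), hlow (none :: L) (by simp),
    iterPd_mul_eq_zero L hV.ofReal_comp ((contDiff_centeredMonomial c γ).natCast _ c)
      fun L' hL' => hlow L' (by omega)]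
  simp only [iterPd_centeredMonomial, mul_zero, zero_add, sub_zero]

end Schroedinger

lemma exists_solution_of_unique {κ : Type*} (s : Finset κ) (M : κ → κ → ℂ)
    (hM : ∀ C : κ → ℂ, (∀ a ∈ s, ∑ b ∈ s, M a b * C b = 0) → ∀ a ∈ s, C a = 0) (y : κ → ℂ) :
    ∃ C : κ → ℂ, ∀ a ∈ s, ∑ b ∈ s, M a b * C b = y a := by
  classical
  let A : Matrix s s ℂ := Matrix.of fun a b => M a b
  let ext : (s → ℂ) → κ → ℂ := fun C a => if h : a ∈ s then C ⟨a, h⟩ else 0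
  have hsum : ∀ (C : s → ℂ) (a : s), A.mulVecLin C a = ∑ b ∈ s, M a b * ext C b := by
    intro C a
    rw [← Finset.sum_coe_sort s]
    simp [A, ext, Matrix.mulVec, dotProduct]
  have hinj : Function.Injective A.mulVecLin := by
    rw [injective_iff_map_eq_zero]
    intro C hC
    funext a
    have := hM (ext C) (fun b hb => by rw [← hsum C ⟨b, hb⟩, hC]; rfl) a a.2
    simpa [ext] using this
  obtain ⟨C, hC⟩ := LinearMap.injective_iff_surjective.mp hinj fun a => y a
  exact ⟨ext C, fun a ha => by rw [← hsum C ⟨a, ha⟩, hC]⟩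

section Trace

variable {d p : ℕ} {c : Pt d}

lemma centeredPoly_sub (B C : (Option (Fin d) → ℕ) → ℂ) (z : Pt d) :
    centeredPoly c p (B - C) z = centeredPoly c p B z - centeredPoly c p C z := by
  simp [centeredPoly, sub_mul, Finset.sum_sub_distrib]

lemma pd_centeredPoly_sub (v : Pt d) (B C : (Option (Fin d) → ℕ) → ℂ) (z : Pt d) :
    pd v (centeredPoly c p (B - C)) z = pd v (centeredPoly c p B) z - pd v (centeredPoly c p C) z := by
  have hdiff : ∀ C, DifferentiableAt ℝ (centeredPoly c p C) z := fun C =>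
    (contDiff_centeredPoly c p C).differentiable (by simp) z
  rw [funext (centeredPoly_sub B C)]
  simp [pd, fderiv_fun_sub (hdiff B) (hdiff C)]

/-- The value on the hyperplane `{axisCoord z i = axisCoord c i}`. -/
lemma centeredPoly_eq_sum_filter_zero (i : Option (Fin d)) (C : (Option (Fin d) → ℕ) → ℂ)
    {z : Pt d} (hz : axisCoord z i = axisCoord c i) :
    centeredPoly c p C z
      = ∑ α ∈ degreeLE d p with α i = 0, C α * centeredMonomial c α z := by
  rw [centeredPoly, Finset.sum_filter]
  refine Finset.sum_congr rfl fun α _ => ?_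
  split_ifs with h
  · rfl
  · rw [centeredMonomial_eq_zero hz h, mul_zero]

/-- The normal derivative on the hyperplane `{axisCoord z i = axisCoord c i}`. -/
lemma pd_centeredPoly_eq_sum_filter_one (i : Option (Fin d)) (C : (Option (Fin d) → ℕ) → ℂ)
    {z : Pt d} (hz : axisCoord z i = axisCoord c i) :
    pd (axisDir d i) (centeredPoly c p C) z
      = ∑ α ∈ degreeLE d p with α i = 1, C α * centeredMonomial c (α - Pi.single i 1) z := by
  have hdiff : ∀ α, DifferentiableAt ℝ (fun z => C α * centeredMonomial c α z) z := fun α =>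
    (contDiff_mul_centeredMonomial c (C α) α).differentiable (by simp) z
  have hmono : ∀ α, fderiv ℝ (centeredMonomial c α) z (axisDir d i)
      = (α i : ℂ) * centeredMonomial c (α - Pi.single i 1) z := fun α =>
    congrFun (pd_centeredMonomial c α i) z
  have hsum : pd (axisDir d i) (centeredPoly c p C) z
      = ∑ α ∈ degreeLE d p, C α * ((α i : ℂ) * centeredMonomial c (α - Pi.single i 1) z) := by
    unfold pd centeredPoly
    rw [fderiv_fun_sum fun α _ => hdiff α, sum_apply]
    refine Finset.sum_congr rfl fun α _ => ?_
    rw [fderiv_const_mul ((contDiff_centeredMonomial c α).differentiable (by simp) z)]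
    simp [hmono]
  rw [hsum, Finset.sum_filter]
  refine Finset.sum_congr rfl fun α _ => ?_
  split_ifs with h
  · simp [h]
  · rcases Nat.eq_zero_or_pos (α i) with h0 | hpos
    · simp [h0]
    · rw [centeredMonomial_eq_zero hz (by simp; omega), mul_zero, mul_zero]

lemma centeredMonomial_eq_of_eq_zero {ℓ : Fin d} {α : Option (Fin d) → ℕ} (h : α (some ℓ) = 0)
    (z : Pt d) (s : ℝ) :
    centeredMonomial c α (Function.update z.1 ℓ s, z.2) = centeredMonomial c α z := by
  refine Finset.prod_congr rfl fun i _ => ?_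
  by_cases hi : i = some ℓ
  · simp [hi, h]
  · cases i with
    | none => rfl
    | some m =>
      have hm : m ≠ ℓ := fun e => hi (congrArg some e)
      simp [axisCoord, hm]

/-- The coefficients in degrees zero and one of the distinguished variable vanish if the Cauchy
data vanish. -/
lemma coeff_eq_zero_of_trace_eq_zero (ℓ : Fin d) {C : (Option (Fin d) → ℕ) → ℂ}
    (h : ∀ z : Pt d, z.1 ℓ = c.1 ℓ →
      centeredPoly c p C z = 0 ∧ pd (eDir d ℓ) (centeredPoly c p C) z = 0) :
    ∀ α ∈ degreeLE d p, α (some ℓ) ≤ 1 → C α = 0 := by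
  have hproj : ∀ z : Pt d, axisCoord (d := d) (Function.update z.1 ℓ (c.1 ℓ), z.2) (some ℓ)
      = axisCoord c (some ℓ) := fun z => by simp [axisCoord]
  have h0 : ∀ z : Pt d, ∑ α ∈ degreeLE d p with α (some ℓ) = 0, C α * centeredMonomial c α z
      = 0 := by
    intro z
    have := (h _ (hproj z)).1
    rw [centeredPoly_eq_sum_filter_zero (some ℓ) C (hproj z)] at this
    rw [← this]
    refine Finset.sum_congr rfl fun α hα => ?_
    rw [centeredMonomial_eq_of_eq_zero (Finset.mem_filter.mp hα).2]
  have h1 : ∀ z : Pt d, ∑ α ∈ degreeLE d p with α (some ℓ) = 1, C α * centeredMonomial c α z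
      = 0 := by
    intro z
    have := (h _ (hproj z)).2
    change pd (axisDir d (some ℓ)) _ _ = 0 at this
    rw [pd_centeredPoly_eq_sum_filter_one (some ℓ) C (hproj z)] at this
    rw [← mul_zero ((axisCoord z (some ℓ) - axisCoord c (some ℓ) : ℝ) : ℂ), ← this, Finset.mul_sum]
    refine Finset.sum_congr rfl fun α hα => ?_
    have hα1 : α (some ℓ) = 1 := (Finset.mem_filter.mp hα).2
    rw [centeredMonomial_eq_of_eq_zero (by simp [hα1])]
    have hfac : centeredMonomial c α z = ((axisCoord z (some ℓ) - axisCoord c (some ℓ) : ℝ) : ℂ)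
        * centeredMonomial c (α - Pi.single (some ℓ) 1) z := by
      rw [centeredMonomial_eq_mul_prod_erase c z α (some ℓ),
        centeredMonomial_eq_mul_prod_erase c z (α - _) (some ℓ)]
      simp only [hα1, pow_one, Pi.sub_apply, Pi.single_eq_same, Nat.sub_self, pow_zero, one_mul]
      congr 1
      refine Finset.prod_congr rfl fun j hj => ?_
      rw [Pi.single_eq_of_ne (Finset.ne_of_mem_erase hj), Nat.sub_zero]
    rw [hfac]
    ring
  intro α hα hle
  rcases Nat.le_one_iff_eq_zero_or_eq_one.mp hle with h' | h'
  · exact coeff_eq_zero_of_sum_eq_zero c h0 α (Finset.mem_filter.mpr ⟨hα, h'⟩)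
  · exact coeff_eq_zero_of_sum_eq_zero c h1 α (Finset.mem_filter.mpr ⟨hα, h'⟩)

end Trace

lemma sub_single_add_single {κ : Type*} [DecidableEq κ] {α : κ → ℕ} {i : κ} {k : ℕ} (h : k ≤ α i) :
    α - Pi.single i k + Pi.single i k = α := by
  funext j
  by_cases hj : j = i
  · subst hj; simp [h]
  · simp [hj]

lemma sum_add_single {κ : Type*} [Fintype κ] [DecidableEq κ] (α : κ → ℕ) (i : κ) (k : ℕ) :
    ∑ j, (α + Pi.single i k : κ → ℕ) j = ∑ j, α j + k := by
  simp [Finset.sum_add_distrib]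

section Recursion

variable {d p : ℕ} {c : Pt d} {V : Pt d → ℝ}

lemma exists_list_Dmi_eq_iterPd_length (j : MI d) :
    ∃ L : List (Option (Fin d)), (fun i => L.count i) = axisIndex j ∧ L.length = MI.deg j ∧
      ∀ f, Dmi j f = iterPd L f := by
  obtain ⟨L, h1, h2⟩ := exists_list_Dmi_eq_iterPd j
  refine ⟨L, h1, ?_, h2⟩
  rw [← sum_axisIndex, ← h1, sum_count_eq_length]

lemma Dmi_Sop_centeredPoly (hV : ContDiffAt ℝ ((p - 2 : ℕ) : WithTop ℕ∞) V c) {j : MI d}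
    (hj : MI.deg j + 2 ≤ p) (C : (Option (Fin d) → ℕ) → ℂ) :
    Dmi j (Sop V (centeredPoly c p C)) c
      = ∑ α ∈ degreeLE d p, C α * Dmi j (Sop V (centeredMonomial c α)) c := by
  obtain ⟨L, -, hlen, hD⟩ := exists_list_Dmi_eq_iterPd_length j
  simp only [hD]
  exact iterPd_Sop_centeredPoly L (hV.of_le (by exact_mod_cast (by omega : L.length ≤ p - 2))) p C

lemma Dmi_Sop_centeredMonomial (hV : ContDiffAt ℝ ((p - 2 : ℕ) : WithTop ℕ∞) V c) {j : MI d}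
    (hj : MI.deg j + 2 ≤ p) {γ : Option (Fin d) → ℕ} (hγ : MI.deg j + 2 ≤ ∑ i, γ i) :
    Dmi j (Sop V (centeredMonomial c γ)) c
      = (1 / 2) * ∑ ℓ : Fin d, if axisIndex j + Pi.single (some ℓ) 2 = γ
          then ∏ i, ((γ i).factorial : ℂ) else 0 := by
  obtain ⟨L, hcount, hlen, hD⟩ := exists_list_Dmi_eq_iterPd_length j
  rw [hD, iterPd_Sop_centeredMonomial L
    (hV.of_le (by exact_mod_cast (by omega : L.length ≤ p - 2))) γ (by omega)]
  congr 1
  refine Finset.sum_congr rfl fun ℓ _ => ?_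
  have heq : (fun i => (some ℓ :: some ℓ :: L).count i) = axisIndex j + Pi.single (some ℓ) 2 := by
    rw [← hcount]
    funext i
    by_cases hi : i = some ℓ
    · subst hi; simp
    · simp [hi, Ne.symm hi]
  exact if_congr (by rw [heq]) rfl rfl

lemma coeff_eq_zero_of_Dmi_Sop_eq_zero (hV : ContDiffAt ℝ ((p - 2 : ℕ) : WithTop ℕ∞) V c)
    (ℓ : Fin d) {C : (Option (Fin d) → ℕ) → ℂ}
    (hlow : ∀ α ∈ degreeLE d p, α (some ℓ) ≤ 1 → C α = 0)
    (hS : ∀ j : MI d, MI.deg j + 2 ≤ p → Dmi j (Sop V (centeredPoly c p C)) c = 0) :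
    ∀ α ∈ degreeLE d p, C α = 0 := by
  suffices h : ∀ n a, ∀ α ∈ degreeLE d p, ∑ i, α i = n → α (some ℓ) = a → C α = 0 from
    fun α hα => h _ _ α hα rfl rfl
  intro n
  induction n using Nat.strong_induction_on with | _ n ihn =>
  intro a
  induction a using Nat.strong_induction_on with | _ a iha =>
  intro α hα hn ha
  by_cases hle : α (some ℓ) ≤ 1
  · exact hlow α hα hle
  obtain ⟨j, rfl⟩ : ∃ j : MI d, axisIndex j + Pi.single (some ℓ) 2 = α :=
    ⟨ofAxisIndex (α - Pi.single (some ℓ) 2), by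
      rw [axisIndex_ofAxisIndex]; exact sub_single_add_single (by omega)⟩
  have hdeg : MI.deg j + 2 = n := by rw [← hn, sum_add_single, sum_axisIndex]
  have hjp : MI.deg j + 2 ≤ p := by rw [hdeg, ← hn]; exact mem_degreeLE.mp hα
  have h := hS j hjp
  rw [Dmi_Sop_centeredPoly hV hjp, Finset.sum_eq_single _ ?_ (fun h => absurd hα h)] at h
  · refine (mul_eq_zero.mp h).resolve_right ?_
    rw [Dmi_Sop_centeredMonomial hV hjp (by omega)]
    have hiff : ∀ m : Fin d, axisIndex j + Pi.single (some m) 2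
        = axisIndex j + Pi.single (some ℓ) 2 ↔ m = ℓ := by
      refine fun m => ⟨fun hm => ?_, fun hm => by rw [hm]⟩
      have := congrFun (add_left_cancel hm) (some m)
      by_contra hne
      simp [hne] at this
    simp only [hiff, Finset.sum_ite_eq', Finset.mem_univ, if_true]
    exact mul_ne_zero (by norm_num) (prod_factorial_ne_zero _)
  · intro γ hγ hne
    rcases lt_or_ge (∑ i, γ i) n with hlt | hge
    · rw [ihn _ hlt _ γ hγ rfl rfl, zero_mul]
    by_cases hlex : ∑ i, γ i = n ∧ γ (some ℓ) < a
    · rw [iha _ hlex.2 γ hγ hlex.1 rfl, zero_mul]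
    rw [Dmi_Sop_centeredMonomial hV hjp (by omega), Finset.sum_eq_zero, mul_zero, mul_zero]
    intro m _
    refine if_neg fun hm => ?_
    have hml : m ≠ ℓ := by rintro rfl; exact hne hm.symm
    refine hlex ⟨by rw [← hm, sum_add_single, sum_axisIndex, hdeg], ?_⟩
    rw [← ha, ← hm]
    simp [hml.symm]

/-- The coefficients in degrees zero and one of the distinguished variable can be prescribed. -/
lemma exists_coeff_of_cauchyData (hV : ContDiffAt ℝ ((p - 2 : ℕ) : WithTop ℕ∞) V c)
    (ℓ : Fin d) (y : (Option (Fin d) → ℕ) → ℂ) :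
    ∃ C : (Option (Fin d) → ℕ) → ℂ, (∀ α ∈ degreeLE d p, α (some ℓ) ≤ 1 → C α = y α) ∧
      ∀ j : MI d, MI.deg j + 2 ≤ p → Dmi j (Sop V (centeredPoly c p C)) c = 0 := by
  let M : (Option (Fin d) → ℕ) → (Option (Fin d) → ℕ) → ℂ := fun α γ =>
    if α (some ℓ) ≤ 1 then (if α = γ then 1 else 0)
    else Dmi (ofAxisIndex (α - Pi.single (some ℓ) 2)) (Sop V (centeredMonomial c γ)) c
  have hMlow : ∀ (C : (Option (Fin d) → ℕ) → ℂ), ∀ α ∈ degreeLE d p, α (some ℓ) ≤ 1 →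
      ∑ γ ∈ degreeLE d p, M α γ * C γ = C α := by
    intro C α hα h
    simp [M, h, hα]
  have hMhigh : ∀ (C : (Option (Fin d) → ℕ) → ℂ) (j : MI d), MI.deg j + 2 ≤ p →
      ∑ γ ∈ degreeLE d p, M (axisIndex j + Pi.single (some ℓ) 2) γ * C γ
        = Dmi j (Sop V (centeredPoly c p C)) c := by
    intro C j hj
    rw [Dmi_Sop_centeredPoly hV hj]
    refine Finset.sum_congr rfl fun γ _ => ?_
    have h : ¬ (axisIndex j + Pi.single (some ℓ) 2 : Option (Fin d) → ℕ) (some ℓ) ≤ 1 := by simp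
    simp only [M, if_neg h, add_tsub_cancel_right, ofAxisIndex_axisIndex]
    ring
  have hmem : ∀ j : MI d, MI.deg j + 2 ≤ p →
      axisIndex j + Pi.single (some ℓ) 2 ∈ degreeLE d p := fun j hj => by
    rwa [mem_degreeLE, sum_add_single, sum_axisIndex]
  obtain ⟨C, hC⟩ := exists_solution_of_unique (degreeLE d p) M (fun C hC =>
    coeff_eq_zero_of_Dmi_Sop_eq_zero hV ℓ
      (fun α hα h => by rw [← hMlow C α hα h, hC α hα])
      fun j hj => by rw [← hMhigh C j hj, hC _ (hmem j hj)])
    fun α => if α (some ℓ) ≤ 1 then y α else 0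
  refine ⟨C, fun α hα h => ?_, fun j hj => ?_⟩
  · rw [← hMlow C α hα h, hC α hα, if_pos h]
  · rw [← hMhigh C j hj, hC _ (hmem j hj), if_neg (by simp)]

end Recursion

/-- Given a polynomial `ĝ` of degree `≤ p` and a polynomial `g̃` of degree
`≤ p−1` in the variables `(x_2,…,x_d,t)` (formalized as polynomial functions on `ℝ^{d+1}`
not depending on `x_1`), there is exactly one `q ∈ QT^p(K)` whose restriction to the
hyperplane `{x_1 = x_K^{(1)}}` is `ĝ` and whose `∂_{x_1}`-derivative restricted to that
hyperplane is `g̃`. -/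
theorem quasiTrefftz_trace_exists_unique
    (d p : ℕ) (hd : 0 < d) (hp : 1 ≤ p)
    (K : Set (Pt d)) (hK : IsOpen K) (cK : Pt d) (hcK : cK ∈ K)
    (V : Pt d → ℝ) (hV : ContDiffOn ℝ (max (p - 2) 0 : ℕ) V K)
    (ghat : Pt d → ℂ) (hghat : ghat ∈ PolySet d p)
    (hghat1 : ∀ z : Pt d, ∀ s : ℝ, ghat (Function.update z.1 ⟨0, hd⟩ s, z.2) = ghat z)
    (gtil : Pt d → ℂ) (hgtil : gtil ∈ PolySet d (p - 1))
    (hgtil1 : ∀ z : Pt d, ∀ s : ℝ, gtil (Function.update z.1 ⟨0, hd⟩ s, z.2) = gtil z) :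
    ∃! q : Pt d → ℂ, q ∈ QTset d p V cK ∧
      ∀ z : Pt d, z.1 ⟨0, hd⟩ = cK.1 ⟨0, hd⟩ →
        q z = ghat z ∧ pd (eDir d ⟨0, hd⟩) q z = gtil z := by
  have hVc : ContDiffAt ℝ ((p - 2 : ℕ) : WithTop ℕ∞) V cK := by
    simpa using hV.contDiffAt (hK.mem_nhds hcK)
  generalize (⟨0, hd⟩ : Fin d) = ℓ at *
  obtain ⟨G, rfl⟩ := (mem_PolySet_iff cK).mp hghat
  obtain ⟨H, rfl⟩ := (mem_PolySet_iff cK).mp hgtil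
  obtain ⟨C, hC, hS⟩ := exists_coeff_of_cauchyData hVc ℓ fun α =>
    if α (some ℓ) = 0 then G α else H (α - Pi.single (some ℓ) 1)
  have htrace : ∀ z : Pt d, z.1 ℓ = cK.1 ℓ → centeredPoly cK p C z = centeredPoly cK p G z ∧
      pd (eDir d ℓ) (centeredPoly cK p C) z = centeredPoly cK (p - 1) H z := by
    refine fun z hz => ⟨?_, (pd_centeredPoly_eq_sum_filter_one (some ℓ) C hz).trans ?_⟩
    · rw [centeredPoly_eq_sum_filter_zero (some ℓ) C hz,
        centeredPoly_eq_sum_filter_zero (some ℓ) G hz]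
      refine Finset.sum_congr rfl fun α hα => ?_
      obtain ⟨hα, h0⟩ := Finset.mem_filter.mp hα
      rw [hC α hα (by omega), if_pos h0]
    · rw [centeredPoly_eq_sum_filter_zero (some ℓ) H hz]
      refine Finset.sum_bij' (fun α _ => α - Pi.single (some ℓ) 1)
        (fun β _ => β + Pi.single (some ℓ) 1) ?_ ?_ ?_ ?_ ?_
      · intro α hα
        obtain ⟨hα, h1⟩ := Finset.mem_filter.mp hα
        rw [mem_degreeLE, ← sub_single_add_single h1.ge, sum_add_single] at hα
        exact Finset.mem_filter.mpr ⟨mem_degreeLE.mpr (by omega), by simp [h1]⟩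
      · intro β hβ
        obtain ⟨hβ, h0⟩ := Finset.mem_filter.mp hβ
        rw [mem_degreeLE] at hβ
        exact Finset.mem_filter.mpr
          ⟨mem_degreeLE.mpr (by rw [sum_add_single]; omega), by simp [h0]⟩
      · exact fun α hα => sub_single_add_single (Finset.mem_filter.mp hα).2.ge
      · exact fun β _ => add_tsub_cancel_right _ _
      · intro α hα
        obtain ⟨hα, h1⟩ := Finset.mem_filter.mp hα
        rw [hC α hα h1.le, if_neg (by omega)]
  refine ⟨centeredPoly cK p C, ⟨⟨(mem_PolySet_iff cK).mpr ⟨C, rfl⟩, hS⟩, htrace⟩, ?_⟩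
  rintro q ⟨⟨hq, hqS⟩, hqtrace⟩
  obtain ⟨B, rfl⟩ := (mem_PolySet_iff cK).mp hq
  have hlow := coeff_eq_zero_of_trace_eq_zero (c := cK) (p := p) ℓ (C := B - C) fun z hz => by
    have hB := hqtrace z hz
    have hz' := htrace z hz
    rw [centeredPoly_sub, pd_centeredPoly_sub, hB.1, hB.2, hz'.1, hz'.2, sub_self, sub_self]
    exact ⟨rfl, rfl⟩
  have hzero := coeff_eq_zero_of_Dmi_Sop_eq_zero hVc ℓ hlow fun j hj => by
    have hB := hqS j hj
    have hCj := hS j hj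
    rw [Dmi_Sop_centeredPoly hVc hj] at hB hCj ⊢
    simp only [Pi.sub_apply, sub_mul, Finset.sum_sub_distrib, hB, hCj, sub_zero]
  funext z
  refine Finset.sum_congr rfl fun α hα => ?_
  rw [sub_eq_zero.mp (hzero α hα)]

end
end

section
/- Let d ∈ ℕ, d ≥ 1, m ∈ ℕ, m ≥ 1, and let Υ ⊂ ℝ^{d+1} be open and bounded with diameter h_Υ, star-shaped with respect to a point (z,s) ∈ Υ. Then for every integer r with 0 ≤ r < m and every φ ∈ C^m(Υ;ℂ) with finite seminorm |φ|_{C^m(Υ)}, |φ − T^m_{(z,s)}φ|_{H^r(Υ)} ≤ C(d+r,d)^{1/2} · ((d+1)^{(m−r)/2} |Υ|^{1/2}/(m−r)!) · h_Υ^{m−r} · |φ|_{C^m(Υ)}, where C(d+r,d) denotes the binomial coefficient and |Υ| is the Lebesgue measure of Υ. -/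
open scoped BigOperators
open MeasureTheory

noncomputable section

/-- The coordinate direction of `ℝ^d × ℝ` labelled by `a`, where `none` is the time direction. -/
def axis {d : ℕ} (a : Option (Fin d)) : Pt d := a.elim (tDir d) (eDir d)

/-- The coordinate of a point along `axis a`. -/
def coord {d : ℕ} (a : Option (Fin d)) (z : Pt d) : ℝ := a.elim z.2 z.1

/-- The exponent of the multi-index `j` in the direction `axis a`. -/
def expo {d : ℕ} (j : MI d) (a : Option (Fin d)) : ℕ := a.elim j.2 j.1

/-- The iterated partial derivative along the directions of a list, outermost first. -/
def pdList {d : ℕ} (L : List (Option (Fin d))) (f : Pt d → ℂ) : Pt d → ℂ :=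
  L.foldr (fun a => pd (axis a)) f

/-- The list of directions in which `Dmi j` differentiates. -/
def indexList {d : ℕ} (j : MI d) : List (Option (Fin d)) :=
  (List.finRange d).flatMap (fun ℓ => List.replicate (j.1 ℓ) (some ℓ)) ++
    List.replicate j.2 none

/-- The monomial with exponents `α` centered at `c`. -/
def monoFun {d : ℕ} (c : Pt d) (α : Option (Fin d) → ℕ) (z : Pt d) : ℂ :=
  ∏ a, (coord a (z - c) : ℂ) ^ α a

section MultiIndex

variable {d : ℕ}

lemma expo_injective : Function.Injective (expo (d := d)) := fun _ _ h =>
  Prod.ext (funext fun ℓ => congrFun h (some ℓ)) (congrFun h none)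

lemma expo_surjective : Function.Surjective (expo (d := d)) := fun α =>
  ⟨(fun ℓ => α (some ℓ), α none), funext fun a => by cases a <;> rfl⟩

lemma sum_expo (j : MI d) : ∑ a, expo j a = j.deg := by
  simp [Fintype.sum_option, expo, MI.deg, add_comm]

lemma prod_factorial_expo (j : MI d) : ∏ a, (expo j a).factorial = j.fact := by
  simp [Fintype.prod_option, expo, MI.fact, mul_comm]

lemma count_indexList (j : MI d) (a : Option (Fin d)) :
    (indexList j).count a = expo j a := by
  cases a with
  | none =>
    simp [indexList, expo, List.count_flatMap, List.count_replicate, Function.comp_def]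
  | some ℓ =>
    simp [indexList, expo, List.count_flatMap, List.count_replicate, Function.comp_def,
      ← Fin.sum_univ_def]

lemma sum_count_eq_length_s8 (L : List (Option (Fin d))) : ∑ a, L.count a = L.length := by
  induction L with
  | nil => simp only [List.count_nil, Finset.sum_const_zero, List.length_nil]
  | cons a L ih =>
    simp only [List.count_cons, beq_iff_eq, Finset.sum_add_distrib, ih, Finset.sum_ite_eq,
      Finset.mem_univ, if_true, List.length_cons]

lemma length_indexList (j : MI d) : (indexList j).length = j.deg := by
  simp only [← sum_count_eq_length_s8, count_indexList, sum_expo]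

lemma exists_perm_indexList (L : List (Option (Fin d))) : ∃ j : MI d, L.Perm (indexList j) := by
  obtain ⟨j, hj⟩ := expo_surjective (fun a => L.count a)
  exact ⟨j, List.perm_iff_count.2 fun a => by rw [count_indexList, hj]⟩

lemma mem_MIall {p : ℕ} {j : MI d} : j ∈ MIall d p ↔ ∀ a, expo j a ≤ p := by
  simp only [MIall, Finset.mem_image, Finset.mem_univ, true_and, Option.forall, expo,
    Option.elim_none, Option.elim_some]
  constructor
  · rintro ⟨i, rfl⟩
    exact ⟨Fin.is_le _, fun ℓ => Fin.is_le _⟩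
  · rintro ⟨h₂, h₁⟩
    exact ⟨(fun ℓ => ⟨j.1 ℓ, Nat.lt_succ_of_le (h₁ ℓ)⟩, ⟨j.2, Nat.lt_succ_of_le h₂⟩), rfl⟩

lemma expo_le_deg (j : MI d) (a : Option (Fin d)) : expo j a ≤ j.deg := by
  rw [← sum_expo]
  exact Finset.single_le_sum (fun _ _ => Nat.zero_le _) (Finset.mem_univ a)

lemma mem_MIlt {m : ℕ} {j : MI d} : j ∈ MIlt d m ↔ j.deg < m := by
  simp only [MIlt, Finset.mem_filter, mem_MIall, and_iff_right_iff_imp]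
  exact fun h a => (expo_le_deg j a).trans h.le

lemma mem_MIeq {m : ℕ} {j : MI d} : j ∈ MIeq d m ↔ j.deg = m := by
  simp only [MIeq, Finset.mem_filter, mem_MIall, and_iff_right_iff_imp]
  exact fun h a => (expo_le_deg j a).trans h.le

lemma card_MIeq_le (r : ℕ) : (MIeq d r).card ≤ (d + r).choose d := by
  have h := Finset.card_le_card_of_injOn (s := MIeq d r)
    (t := (Finset.univ : Finset (Option (Fin d))).finsuppAntidiag r)
    (fun j => Finsupp.equivFunOnFinite.symm (expo j))
    (fun j hj => by
      rw [Finset.mem_coe, Finset.mem_finsuppAntidiag]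
      exact ⟨(sum_expo j).trans (mem_MIeq.1 hj), Finset.subset_univ _⟩)
    (fun _ _ _ _ hij => expo_injective (Finsupp.equivFunOnFinite.symm.injective hij))
  refine h.trans_eq ?_
  rw [Finset.card_finsuppAntidiag_nat_eq_choose, Finset.card_univ, Fintype.card_option,
    Fintype.card_fin, Nat.choose_symm_add (a := d) (b := r)]
  congr 1
  omega

lemma Dmi_eq_pdList (j : MI d) (f : Pt d → ℂ) : Dmi j f = pdList (indexList j) f := by
  have key (a : Option (Fin d)) (n : ℕ) (g : Pt d → ℂ) :
      (List.replicate n a).foldr (fun a => pd (axis a)) g = (pd (axis a))^[n] g := by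
    induction n with
    | zero => rfl
    | succ n ih => rw [List.replicate_succ, List.foldr_cons, ih, Function.iterate_succ_apply']
  simp only [pdList, indexList, List.foldr_append, List.foldr_flatMap, key]
  rfl

lemma monoC_one_eq_monoFun (c : Pt d) (j : MI d) : monoC c 1 j = monoFun c (expo j) := by
  ext z
  simp [monoC, monoFun, Fintype.prod_option, coord, expo, mul_comm]

lemma sum_coord_smul_axis (z : Pt d) : ∑ a, coord a z • axis a = z := by
  ext i <;> simp [Fintype.sum_option, coord, axis, tDir, eDir, eVecd, Prod.fst_sum, Prod.snd_sum]

lemma coord_add (a : Option (Fin d)) (z w : Pt d) : coord a (z + w) = coord a z + coord a w := by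
  cases a <;> rfl

lemma coord_smul (a : Option (Fin d)) (t : ℝ) (z : Pt d) : coord a (t • z) = t * coord a z := by
  cases a <;> rfl

lemma coord_axis (a b : Option (Fin d)) : coord a (axis b) = if a = b then 1 else 0 := by
  cases a <;> cases b <;> simp [coord, axis, tDir, eDir, eVecd]

lemma contDiff_coord {n : ℕ∞} (a : Option (Fin d)) : ContDiff ℝ n (coord (d := d) a) := by
  cases a with
  | none => exact contDiff_snd
  | some ℓ => exact (contDiff_apply ℝ ℝ ℓ).comp contDiff_fst

lemma contDiff_monoFun {n : ℕ∞} (c : Pt d) (α : Option (Fin d) → ℕ) :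
    ContDiff ℝ n (monoFun c α) := by
  refine contDiff_prod fun a _ => ContDiff.pow ?_ _
  exact Complex.ofRealCLM.contDiff.comp
    ((contDiff_coord a).comp (contDiff_id.sub contDiff_const))

lemma sum_abs_coord_sub_le (z w : Pt d) :
    ∑ a, |coord a (z - w)| ≤ √((d : ℝ) + 1) * eDist w z := by
  rw [eDist, ← Real.sqrt_mul (by positivity)]
  refine Real.le_sqrt_of_sq_le ?_
  refine (sq_sum_le_card_mul_sum_sq (s := Finset.univ)).trans_eq ?_
  simp [Fintype.sum_option, coord, sub_sq_comm, add_comm]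

end MultiIndex

section IteratedPartial

variable {d : ℕ} {Υ : Set (Pt d)}

lemma pd_contDiffOn (hΥ : IsOpen Υ) {f : Pt d → ℂ} {n : ℕ} (v : Pt d)
    (hf : ContDiffOn ℝ (n + 1 : ℕ) f Υ) : ContDiffOn ℝ n (pd v f) Υ :=
  (hf.fderiv_of_isOpen hΥ (m := n) (by norm_cast)).clm_apply contDiffOn_const

lemma pd_eqOn (hΥ : IsOpen Υ) {f g : Pt d → ℂ} (v : Pt d) (h : Set.EqOn f g Υ) :
    Set.EqOn (pd v f) (pd v g) Υ := fun z hz => by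
  simp only [pd, (h.eventuallyEq_of_mem (hΥ.mem_nhds hz)).fderiv_eq]

lemma pd_comm_eqOn (hΥ : IsOpen Υ) {f : Pt d → ℂ} (v w : Pt d) (hf : ContDiffOn ℝ 2 f Υ) :
    Set.EqOn (pd v (pd w f)) (pd w (pd v f)) Υ := fun z hz => by
  have hs : IsSymmSndFDerivAt ℝ f z :=
    (hf.contDiffAt (hΥ.mem_nhds hz)).isSymmSndFDerivAt (by simp)
  have hd : DifferentiableAt ℝ (fderiv ℝ f) z :=
    ((hf.fderiv_of_isOpen hΥ (m := 1) (by norm_num)).contDiffAt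
      (hΥ.mem_nhds hz)).differentiableAt (by norm_num)
  have key (v w : Pt d) : pd v (pd w f) z = fderiv ℝ (fderiv ℝ f) z v w := by
    change fderiv ℝ (fun y => fderiv ℝ f y w) z v = _
    rw [fderiv_clm_apply hd (differentiableAt_const w)]
    simp
  rw [key, key, hs.eq]

lemma pdList_append (L K : List (Option (Fin d))) (f : Pt d → ℂ) :
    pdList (L ++ K) f = pdList L (pdList K f) := by simp [pdList]

lemma pdList_contDiffOn (hΥ : IsOpen Υ) {f : Pt d → ℂ} (L : List (Option (Fin d))) {n : ℕ}
    (hf : ContDiffOn ℝ (L.length + n : ℕ) f Υ) : ContDiffOn ℝ n (pdList L f) Υ := by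
  induction L generalizing n with
  | nil => exact hf.of_le (by simp)
  | cons a L ih =>
    refine pd_contDiffOn hΥ _ (ih ?_)
    rwa [List.length_cons, add_assoc, add_comm 1] at hf

lemma pdList_eqOn_of_perm (hΥ : IsOpen Υ) {f : Pt d → ℂ} {L K : List (Option (Fin d))}
    (h : L.Perm K) (hf : ContDiffOn ℝ L.length f Υ) : Set.EqOn (pdList L f) (pdList K f) Υ := by
  induction h with
  | nil => exact fun _ _ => rfl
  | cons a h ih => exact pd_eqOn hΥ _ (ih (hf.of_le (by norm_cast; simp)))
  | swap a b L => exact pd_comm_eqOn hΥ _ _ (pdList_contDiffOn hΥ L hf)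
  | trans h₁ h₂ ih₁ ih₂ => exact (ih₁ hf).trans (ih₂ (h₁.length_eq ▸ hf))

lemma pdList_sub_eqOn (hΥ : IsOpen Υ) {f g : Pt d → ℂ} (L : List (Option (Fin d)))
    (hf : ContDiffOn ℝ L.length f Υ) (hg : ContDiffOn ℝ L.length g Υ) :
    Set.EqOn (pdList L (fun z => f z - g z)) (fun z => pdList L f z - pdList L g z) Υ := by
  induction L with
  | nil => exact fun _ _ => rfl
  | cons a L ih =>
    refine (pd_eqOn hΥ _ (ih (hf.of_le (by norm_cast; simp))
      (hg.of_le (by norm_cast; simp)))).trans fun z hz => ?_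
    have hd {f : Pt d → ℂ} (hf : ContDiffOn ℝ (a :: L).length f Υ) :
        DifferentiableAt ℝ (pdList L f) z :=
      ((pdList_contDiffOn hΥ L (n := 1) hf).contDiffAt (hΥ.mem_nhds hz)).differentiableAt
        (by norm_num)
    change fderiv ℝ _ z _ = _
    rw [fderiv_fun_sub (hd hf) (hd hg)]
    rfl

lemma pdList_contDiff {f : Pt d → ℂ} (hf : ∀ n : ℕ, ContDiff ℝ n f)
    (L : List (Option (Fin d))) (n : ℕ) : ContDiff ℝ n (pdList L f) :=
  contDiffOn_univ.1 (pdList_contDiffOn isOpen_univ L (hf _).contDiffOn)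

lemma pdList_const_mul {f : Pt d → ℂ} (hf : ∀ n : ℕ, ContDiff ℝ n f)
    (L : List (Option (Fin d))) (c : ℂ) :
    pdList L (fun z => c * f z) = fun z => c * pdList L f z := by
  induction L with
  | nil => rfl
  | cons a L ih =>
    ext z
    change fderiv ℝ (pdList L (fun z => c * f z)) z _ = _
    rw [ih, fderiv_const_mul ((pdList_contDiff hf L 1).differentiable (by norm_num) z)]
    rfl

lemma pdList_sum {ι : Type*} (s : Finset ι) {f : ι → Pt d → ℂ}
    (hf : ∀ i, ∀ n : ℕ, ContDiff ℝ n (f i)) (L : List (Option (Fin d))) :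
    pdList L (fun z => ∑ i ∈ s, f i z) = fun z => ∑ i ∈ s, pdList L (f i) z := by
  induction L with
  | nil => rfl
  | cons a L ih =>
    ext z
    change fderiv ℝ (pdList L (fun z => ∑ i ∈ s, f i z)) z _ = _
    rw [ih, fderiv_fun_sum fun i _ =>
      (pdList_contDiff (hf i) L 1).differentiable (by norm_num) z]
    simp only [sum_apply]
    rfl

end IteratedPartial

section Monomial

variable {d : ℕ}

lemma pd_axis_monoFun (c : Pt d) (α : Option (Fin d) → ℕ) (a : Option (Fin d)) :
    pd (axis a) (monoFun c α) =
      fun z => (α a : ℂ) * monoFun c (Function.update α a (α a - 1)) z := by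
  ext z
  have hd : DifferentiableAt ℝ (monoFun c α) z :=
    (contDiff_monoFun (n := 1) c α).differentiable (by norm_num) z
  change fderiv ℝ _ z _ = _
  rw [← hd.lineDeriv_eq_fderiv, lineDeriv]
  have hline : (fun t : ℝ => monoFun c α (z + t • axis a)) = fun t : ℝ =>
      ((coord a (z - c) + t : ℝ) : ℂ) ^ α a *
        ∏ b ∈ Finset.univ.erase a, (coord b (z - c) : ℂ) ^ α b := by
    ext t
    rw [monoFun, ← Finset.mul_prod_erase _ _ (Finset.mem_univ a)]
    have h (b) : coord b (z + t • axis a - c) = coord b (z - c) + t * if b = a then 1 else 0 := by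
      rw [← coord_axis, ← coord_smul, ← coord_add]
      congr 1
      abel
    congr 1
    · simp [h]
    · refine Finset.prod_congr rfl fun b hb => ?_
      simp [h, Finset.ne_of_mem_erase hb]
  have hpow : HasDerivAt (fun t : ℝ => ((coord a (z - c) + t : ℝ) : ℂ) ^ α a)
      ((α a : ℂ) * (coord a (z - c) : ℂ) ^ (α a - 1)) 0 := by
    refine ((((hasDerivAt_id (0 : ℝ)).const_add (coord a (z - c))).ofReal_comp).fun_pow
      (α a)).congr_deriv ?_
    simp
  rw [hline, (hpow.mul_const _).deriv, monoFun, ← Finset.mul_prod_erase _ _ (Finset.mem_univ a),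
    Function.update_self, mul_assoc]
  congr 2
  refine Finset.prod_congr rfl fun b hb => ?_
  rw [Function.update_of_ne (Finset.ne_of_mem_erase hb)]

lemma pdList_concat_monoFun (c : Pt d) (α : Option (Fin d) → ℕ) (L : List (Option (Fin d)))
    (a : Option (Fin d)) :
    pdList (L ++ [a]) (monoFun c α) =
      fun z => (α a : ℂ) * pdList L (monoFun c (Function.update α a (α a - 1))) z := by
  rw [pdList_append, ← pdList_const_mul (fun n => contDiff_monoFun c _)]
  exact congrArg (pdList L) (pd_axis_monoFun c α a)

lemma pdList_monoFun_eq_zero (c : Pt d) (α : Option (Fin d) → ℕ) (L : List (Option (Fin d)))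
    (h : ∑ a, α a < L.length) : pdList L (monoFun c α) = 0 := by
  induction L using List.reverseRecOn generalizing α with
  | nil => simp at h
  | append_singleton L a ih =>
    rw [pdList_concat_monoFun]
    rcases Nat.eq_zero_or_pos (α a) with ha | ha
    · simp [ha]; rfl
    · rw [ih]
      · simp; rfl
      · rw [Finset.sum_update_of_mem (Finset.mem_univ a), ← Finset.erase_eq]
        rw [← Finset.add_sum_erase _ _ (Finset.mem_univ a)] at h
        simp at h
        omega

lemma pdList_monoFun_self (c : Pt d) (α : Option (Fin d) → ℕ) (L : List (Option (Fin d))) :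
    pdList L (monoFun c α) c =
      if α = fun a => L.count a then ((∏ a, (α a).factorial : ℕ) : ℂ) else 0 := by
  induction L using List.reverseRecOn generalizing α with
  | nil =>
    have h0 (a : Option (Fin d)) : coord a (0 : Pt d) = 0 := by cases a <;> rfl
    simp only [pdList, List.foldr_nil, monoFun, sub_self, h0, Complex.ofReal_zero]
    by_cases h : α = fun a => ([] : List (Option (Fin d))).count a
    · rw [if_pos h]
      simp [h]
    · obtain ⟨a, ha⟩ := Function.ne_iff.1 h
      rw [if_neg h]
      exact Finset.prod_eq_zero (Finset.mem_univ a) (zero_pow ha)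
  | append_singleton L a ih =>
    rw [pdList_concat_monoFun]
    simp only [ih]
    rcases Nat.eq_zero_or_pos (α a) with ha | ha
    · have : α ≠ fun b => (L ++ [a]).count b := fun h => by
        have := congrFun h a
        simp [ha] at this
      rw [ha, if_neg this, Nat.cast_zero, zero_mul]
    · have hiff : (Function.update α a (α a - 1) = fun b => L.count b) ↔
          α = fun b => (L ++ [a]).count b := by
        simp only [funext_iff]
        refine forall_congr' fun b => ?_
        rcases eq_or_ne b a with rfl | hb
        · simp; omega
        · simp [hb, hb.symm]
      simp only [hiff, mul_ite, mul_zero]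
      congr 1
      rw [← Finset.mul_prod_erase _ _ (Finset.mem_univ a),
        ← Finset.mul_prod_erase _ (fun b => (α b).factorial) (Finset.mem_univ a),
        Function.update_self]
      rw [← Nat.mul_factorial_pred ha.ne']
      push_cast
      rw [mul_assoc]
      congr 2
      refine Finset.prod_congr rfl fun b hb => ?_
      rw [Function.update_of_ne (Finset.ne_of_mem_erase hb)]

end Monomial

section Taylor

variable {d : ℕ}

lemma contDiff_taylorP (m : ℕ) (c : Pt d) (φ : Pt d → ℂ) (n : ℕ) :
    ContDiff ℝ n (TaylorP m c φ) := by
  refine ContDiff.sum fun j _ => contDiff_const.mul ?_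
  rw [monoC_one_eq_monoFun]
  exact contDiff_monoFun c _

lemma pdList_taylorP (m : ℕ) (c : Pt d) (φ : Pt d → ℂ) (L : List (Option (Fin d))) :
    pdList L (TaylorP m c φ) = fun z => ∑ j ∈ MIlt d m,
      ((MI.fact j : ℂ))⁻¹ * Dmi j φ c * pdList L (monoFun c (expo j)) z := by
  have hmono (j : MI d) (n : ℕ) : ContDiff ℝ n (monoFun c (expo j)) := contDiff_monoFun c _
  have hT : TaylorP m c φ = fun z => ∑ j ∈ MIlt d m,
      ((MI.fact j : ℂ))⁻¹ * Dmi j φ c * monoFun c (expo j) z := by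
    unfold TaylorP
    simp only [monoC_one_eq_monoFun]
  rw [hT, pdList_sum _ fun j n => contDiff_const.mul (hmono j n)]
  simp only [pdList_const_mul (hmono _)]

lemma pdList_taylorP_of_le {m : ℕ} (c : Pt d) (φ : Pt d → ℂ) {L : List (Option (Fin d))}
    (h : m ≤ L.length) : pdList L (TaylorP m c φ) = 0 := by
  rw [pdList_taylorP]
  ext z
  refine Finset.sum_eq_zero fun j hj => ?_
  rw [pdList_monoFun_eq_zero c _ L ((sum_expo j).trans_lt ((mem_MIlt.1 hj).trans_le h))]
  simp

lemma pdList_taylorP_center {m : ℕ} {Υ : Set (Pt d)} (hΥ : IsOpen Υ) {c : Pt d} (hc : c ∈ Υ)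
    {φ : Pt d → ℂ} (hφ : ContDiffOn ℝ m φ Υ) {L : List (Option (Fin d))} (h : L.length < m) :
    pdList L (TaylorP m c φ) c = pdList L φ c := by
  obtain ⟨j, hj⟩ := exists_perm_indexList L
  have hcount : (fun a => L.count a) = expo j := funext fun a => by
    rw [hj.count_eq, count_indexList]
  have hjm : j ∈ MIlt d m := by rwa [mem_MIlt, ← length_indexList, ← hj.length_eq]
  rw [pdList_taylorP]
  simp only [pdList_monoFun_self, hcount, expo_injective.eq_iff, prod_factorial_expo]
  rw [Finset.sum_eq_single_of_mem j hjm fun i _ hi => by simp [hi]]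
  have hne : (j.fact : ℂ) ≠ 0 := by
    rw [← prod_factorial_expo]
    exact_mod_cast Finset.prod_ne_zero_iff.2 fun a _ => Nat.factorial_ne_zero _
  rw [if_pos rfl, mul_right_comm, inv_mul_cancel₀ hne, one_mul, Dmi_eq_pdList]
  exact (pdList_eqOn_of_perm hΥ hj (hφ.of_le (by exact_mod_cast h.le)) hc).symm

lemma norm_pdList_le_of_center_eq_zero {m : ℕ} {Υ : Set (Pt d)} (hΥ : IsOpen Υ) {c : Pt d}
    (hstar : ∀ z ∈ Υ, segment ℝ c z ⊆ Υ) {G : Pt d → ℂ} (hG : ContDiffOn ℝ m G Υ)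
    (hzero : ∀ L, L.length < m → pdList L G c = 0) {M : ℝ}
    (hM : ∀ L, L.length = m → ∀ z ∈ Υ, ‖pdList L G z‖ ≤ M) (n : ℕ) :
    ∀ L : List (Option (Fin d)), L.length + n = m → ∀ z ∈ Υ,
      ‖pdList L G z‖ ≤ M * (∑ a, |coord a (z - c)|) ^ n / n.factorial := by
  induction n with
  | zero => intro L hL z hz; simpa using hM L hL z hz
  | succ n ih =>
    intro L hL z hz
    set v := z - c with hv
    set Λ := ∑ a, |coord a v| with hΛ
    have hmem {t : ℝ} (ht : t ∈ Set.Icc (0 : ℝ) 1) : c + t • v ∈ Υ := by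
      refine hstar z hz ?_
      rw [segment_eq_image']
      exact ⟨t, ht, rfl⟩
    have hderiv {t : ℝ} (ht : t ∈ Set.Icc (0 : ℝ) 1) :
        HasDerivAt (fun t : ℝ => pdList L G (c + t • v))
          (fderiv ℝ (pdList L G) (c + t • v) v) t := by
      have hd : DifferentiableAt ℝ (pdList L G) (c + t • v) :=
        ((pdList_contDiffOn hΥ L (n := 1) (hG.of_le (by norm_cast; omega))).contDiffAt
          (hΥ.mem_nhds (hmem ht))).differentiableAt (by norm_num)
      have hl : HasDerivAt (fun t : ℝ => c + t • v) v t := by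
        simpa using ((hasDerivAt_id t).smul_const v).const_add c
      exact hd.hasFDerivAt.comp_hasDerivAt t hl
    have hbound {t : ℝ} (ht : t ∈ Set.Icc (0 : ℝ) 1) :
        ‖fderiv ℝ (pdList L G) (c + t • v) v‖ ≤ Λ * (M * (t * Λ) ^ n / n.factorial) := by
      have hsum : fderiv ℝ (pdList L G) (c + t • v) v =
          ∑ a, coord a v • pdList (a :: L) G (c + t • v) := by
        conv_lhs => arg 2; rw [← sum_coord_smul_axis v]
        simp only [map_sum, map_smul]
        rfl
      rw [hsum]
      conv_rhs => rw [hΛ, Finset.sum_mul]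
      refine (norm_sum_le _ _).trans (Finset.sum_le_sum fun a _ => ?_)
      rw [norm_smul, Real.norm_eq_abs]
      gcongr
      refine (ih (a :: L) (by simp; omega) _ (hmem ht)).trans_eq ?_
      simp only [add_sub_cancel_left, coord_smul, abs_mul, abs_of_nonneg ht.1,
        ← Finset.mul_sum]
    have hB (t : ℝ) : HasDerivAt (fun t : ℝ => M * (t * Λ) ^ (n + 1) / (n + 1).factorial)
        (Λ * (M * (t * Λ) ^ n / n.factorial)) t := by
      refine (((((hasDerivAt_id t).mul_const Λ).pow (n + 1)).const_mul M).div_const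
        _).congr_deriv ?_
      rw [Nat.factorial_succ]
      have : (n.factorial : ℝ) ≠ 0 := by positivity
      push_cast
      simp
      field_simp
    have := image_norm_le_of_norm_deriv_right_le_deriv_boundary (a := 0) (b := 1)
      (fun t ht => (hderiv ht).continuousAt.continuousWithinAt)
      (fun t ht => (hderiv (Set.Ico_subset_Icc_self ht)).hasDerivWithinAt)
      (by simp [hzero L (by omega)]) hB (fun t ht => hbound (Set.Ico_subset_Icc_self ht))
      (Set.right_mem_Icc.2 zero_le_one)
    simpa [hv] using this

lemma norm_Dmi_sub_taylorP_le {m : ℕ} {Υ : Set (Pt d)} (hΥ : IsOpen Υ) {c : Pt d} (hc : c ∈ Υ)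
    (hstar : ∀ z ∈ Υ, segment ℝ c z ⊆ Υ) {φ : Pt d → ℂ} (hφ : ContDiffOn ℝ m φ Υ) {M : ℝ}
    (hM : ∀ j : MI d, j.deg = m → ∀ z ∈ Υ, ‖Dmi j φ z‖ ≤ M) {j : MI d} (hj : j.deg ≤ m)
    {z : Pt d} (hz : z ∈ Υ) :
    ‖Dmi j (fun w => φ w - TaylorP m c φ w) z‖ ≤
      M * (∑ a, |coord a (z - c)|) ^ (m - j.deg) / (m - j.deg).factorial := by
  have hT : ContDiffOn ℝ m (TaylorP m c φ) Υ := (contDiff_taylorP m c φ m).contDiffOn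
  have hsub {L : List (Option (Fin d))} (hL : L.length ≤ m) :=
    pdList_sub_eqOn hΥ L (hφ.of_le (by exact_mod_cast hL)) (hT.of_le (by exact_mod_cast hL))
  rw [Dmi_eq_pdList]
  refine norm_pdList_le_of_center_eq_zero hΥ hstar (hφ.sub hT) (fun L hL => ?_)
    (fun L hL w hw => ?_) _ _ (by rw [length_indexList]; omega) z hz
  · rw [hsub hL.le hc]
    simp only [pdList_taylorP_center hΥ hc hφ hL, sub_self]
  · obtain ⟨i, hi⟩ := exists_perm_indexList L
    rw [hsub hL.le hw]
    simp only [pdList_taylorP_of_le c φ hL.ge, Pi.zero_apply, sub_zero]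
    rw [pdList_eqOn_of_perm hΥ hi (hL ▸ hφ) hw, ← Dmi_eq_pdList]
    exact hM i (by rw [← length_indexList, ← hi.length_eq, hL]) w hw

end Taylor

/-- `H^r` Taylor remainder bound on a star-shaped domain: for `0 ≤ r < m`,
`|φ − T^m_{(z,s)}φ|_{H^r(Υ)} ≤ C(d+r,d)^{1/2}·((d+1)^{(m−r)/2}|Υ|^{1/2}/(m−r)!)·h_Υ^{m−r}·|φ|_{C^m(Υ)}`,
with `M = |φ|_{C^m(Υ)}` a (finite) bound on all order-`m` derivatives of `φ` on `Υ`. -/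
theorem taylor_remainder_Hr
    (d m : ℕ) (hd : 1 ≤ d) (hm : 1 ≤ m)
    (Υ : Set (Pt d)) (hopen : IsOpen Υ) (hbdd : Bornology.IsBounded Υ)
    (hΥ : ℝ) (hdiam : IsLUB (Set.image2 (fun z w => eDist z w) Υ Υ) hΥ)
    (zs : Pt d) (hzs : zs ∈ Υ)
    (hstar : ∀ xt ∈ Υ, segment ℝ zs xt ⊆ Υ)
    (φ : Pt d → ℂ) (hφ : ContDiffOn ℝ (m : ℕ) φ Υ)
    (M : ℝ) (hM : ∀ j : MI d, MI.deg j = m → ∀ z ∈ Υ, ‖Dmi j φ z‖ ≤ M)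
    (r : ℕ) (hr : r < m) :
    Real.sqrt (∑ j ∈ MIeq d r,
        ∫ z in Υ, ‖Dmi j (fun w => φ w - TaylorP m zs φ w) z‖ ^ 2) ≤
      Real.sqrt (Nat.choose (d + r) d : ℝ) *
        (((d : ℝ) + 1) ^ (((m : ℝ) - (r : ℝ)) / 2) * Real.sqrt (volume Υ).toReal
          / (Nat.factorial (m - r) : ℝ))
        * hΥ ^ (m - r) * M := by
  have hM0 : 0 ≤ M := by
    have hdeg : MI.deg ((fun _ => 0, m) : MI d) = m := by simp [MI.deg]
    exact (norm_nonneg _).trans (hM _ hdeg zs hzs)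
  have hfin : volume Υ < ⊤ := hbdd.measure_lt_top
  have hdist {z : Pt d} (hz : z ∈ Υ) : eDist zs z ≤ hΥ :=
    hdiam.1 (Set.mem_image2_of_mem hzs hz)
  have hΥ0 : 0 ≤ hΥ := (Real.sqrt_nonneg _).trans (hdist hzs)
  set B : ℝ := M * (√((d : ℝ) + 1) * hΥ) ^ (m - r) / (m - r).factorial with hB
  have hB0 : 0 ≤ B := by positivity
  have hpt {j : MI d} (hj : j ∈ MIeq d r) {z : Pt d} (hz : z ∈ Υ) :
      ‖Dmi j (fun w => φ w - TaylorP m zs φ w) z‖ ≤ B := by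
    obtain rfl := mem_MIeq.1 hj
    refine (norm_Dmi_sub_taylorP_le hopen hzs hstar hφ hM hr.le hz).trans ?_
    rw [hB]
    gcongr
    exact (sum_abs_coord_sub_le z zs).trans (by gcongr; exact hdist hz)
  have hint {j : MI d} (hj : j ∈ MIeq d r) :
      ∫ z in Υ, ‖Dmi j (fun w => φ w - TaylorP m zs φ w) z‖ ^ 2 ≤
        B ^ 2 * (volume Υ).toReal := by
    refine (Real.le_norm_self _).trans (norm_setIntegral_le_of_norm_le_const hfin fun z hz => ?_)
    rw [norm_pow, norm_norm]
    exact pow_le_pow_left₀ (norm_nonneg _) (hpt hj hz) 2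
  have hsum : ∑ j ∈ MIeq d r, ∫ z in Υ, ‖Dmi j (fun w => φ w - TaylorP m zs φ w) z‖ ^ 2 ≤
      (d + r).choose d * (B ^ 2 * (volume Υ).toReal) := by
    refine (Finset.sum_le_card_nsmul _ _ _ fun j hj => hint hj).trans ?_
    rw [nsmul_eq_mul]
    gcongr
    exact card_MIeq_le r
  refine (Real.sqrt_le_sqrt hsum).trans_eq ?_
  have hpow : ((d : ℝ) + 1) ^ (((m : ℝ) - (r : ℝ)) / 2) = √((d : ℝ) + 1) ^ (m - r) := by
    rw [Real.sqrt_eq_rpow, ← Real.rpow_mul_natCast (by positivity), Nat.cast_sub hr.le]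
    congr 1
    ring
  rw [Real.sqrt_mul (by positivity), Real.sqrt_mul (by positivity), Real.sqrt_sq hB0, hpow, hB,
    mul_pow]
  ring

end
end
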